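/- arXiv:2404.10729 — 3 statements merged into one kernel-verified Lean document; each statement's English description precedes it below -/
import Mathlib

section
/- Let n ≥ 3 and M_(n) = (x_i y_j z_k : 1 ≤ i < j < k ≤ n) ⊆ R = K[x_i,y_i,z_i : i ∈ [n]]. Then the height of M_(n) equals n - 2. -/
open MvPolynomial

/-- The polynomial ring `K[x_i, y_i, z_i : 1 ≤ i ≤ n]`. -/
abbrev PR (K : Type) [Field K] (n : ℕ) := MvPolynomial (Fin 3 × Fin n) K

noncomputable def xv (K : Type) [Field K] (n : ℕ) (i : Fin n) : PR K n := X (0, i)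
noncomputable def yv (K : Type) [Field K] (n : ℕ) (i : Fin n) : PR K n := X (1, i)
noncomputable def zv (K : Type) [Field K] (n : ℕ) (i : Fin n) : PR K n := X (2, i)

/-- The diagonal matching field ideal `M_(n) = (x_i y_j z_k : 1 ≤ i < j < k ≤ n)`. -/
noncomputable def Mn (K : Type) [Field K] (n : ℕ) : Ideal (PR K n) :=
  Ideal.span {m | ∃ i j k : Fin n, i < j ∧ j < k ∧ m = xv K n i * yv K n j * zv K n k}

/-- The height of an ideal: the infimum, over the prime ideals containing it, of their
heights in the prime spectrum (this equals the minimum of the heights of its minimal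
primes). -/
noncomputable def idealHeight {R : Type} [CommRing R] (I : Ideal R) : ℕ∞ :=
  ⨅ (p : PrimeSpectrum R) (_ : I ≤ p.asIdeal), Order.height p


open Classical in
/-- The substitution killing the variables in `S`. -/
noncomputable def killS (K : Type) [Field K] {σ : Type} (S : Finset σ) :
    MvPolynomial σ K →ₐ[K] MvPolynomial σ K :=
  aeval (fun i => if i ∈ S then 0 else X i)

instance killS_prime (K : Type) [Field K] {σ : Type} (S : Finset σ) :
    (RingHom.ker (killS K S)).IsPrime := RingHom.ker_isPrime _

lemma killS_X (K : Type) [Field K] {σ : Type} (S : Finset σ) (i : σ) :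
    X i ∈ RingHom.ker (killS K S) ↔ i ∈ S := by
  classical
  rw [RingHom.mem_ker, killS, aeval_X]
  split_ifs with h <;> simp [h]

lemma ker_killS_le (K : Type) [Field K] {σ : Type} (S : Finset σ)
    (p : Ideal (MvPolynomial σ K)) (h : ∀ i ∈ S, X i ∈ p) :
    RingHom.ker (killS K S) ≤ p := by
  classical
  have key : (Ideal.Quotient.mkₐ K p).comp (killS K S) = Ideal.Quotient.mkₐ K p := by
    apply MvPolynomial.algHom_ext
    intro i
    rw [AlgHom.comp_apply, killS, aeval_X]
    split_ifs with hi
    · rw [map_zero]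
      exact (Ideal.Quotient.eq_zero_iff_mem.2 (h i hi)).symm
    · rfl
  intro f hf
  rw [RingHom.mem_ker] at hf
  have := DFunLike.congr_fun key f
  rw [AlgHom.comp_apply, hf, map_zero] at this
  exact Ideal.Quotient.eq_zero_iff_mem.1 this.symm

lemma card_le_height_ker (K : Type) [Field K] {σ : Type} (S : Finset σ) :
    (S.card : ℕ∞) ≤ (RingHom.ker (killS K S)).height := by
  classical
  induction S using Finset.induction_on with
  | empty => simp
  | insert a S ha ih =>
    rw [Finset.card_insert_of_notMem ha]
    have hlt : RingHom.ker (killS K S) < RingHom.ker (killS K (insert a S)) := by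
      refine lt_of_le_of_ne ?_ ?_
      · apply ker_killS_le
        intro i hi
        exact (killS_X K _ i).2 (Finset.mem_insert_of_mem hi)
      · intro h
        have h1 := (killS_X K (insert a S) a).2 (Finset.mem_insert_self _ _)
        rw [← h] at h1
        exact ha ((killS_X K S a).1 h1)
    have := Ideal.height_add_one_le_of_lt_of_isPrime hlt
    refine le_trans ?_ this
    push_cast
    gcongr

lemma idealHeight_eq {R : Type} [CommRing R] (I : Ideal R) : idealHeight I ≤ I.height := by
  rw [Ideal.height_eq_inf_minimalPrimes]
  refine le_iInf₂ fun J hJ => ?_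
  have hp : J.IsPrime := hJ.1.1
  refine (iInf₂_le (⟨J, hp⟩ : PrimeSpectrum R) hJ.1.2).trans ?_
  rw [← PrimeSpectrum.height_eq_orderHeight]

lemma upper (K : Type) [Field K] (m : ℕ) : idealHeight (Mn K (m + 2)) ≤ (m : ℕ∞) := by
  classical
  set g : Fin m → PR K (m + 2) := fun i => X ((0 : Fin 3), Fin.castAdd 2 i)
  have hle : Mn K (m + 2) ≤ Ideal.span (Set.range g) := by
    rw [Mn, Ideal.span_le]
    rintro _ ⟨i, j, k, hij, hjk, rfl⟩
    have hi : (i : ℕ) < m := by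
      have := k.2
      simp only [Fin.lt_def] at hij hjk
      omega
    rw [mul_assoc]
    apply Ideal.mul_mem_right
    exact Ideal.subset_span ⟨⟨i, hi⟩, rfl⟩
  have hne : Ideal.span (Set.range g) ≠ ⊤ := by
    intro h
    have h2 : Ideal.span (Set.range g) ≤
        RingHom.ker (killS K (Finset.univ : Finset (Fin 3 × Fin (m + 2)))) := by
      rw [Ideal.span_le]
      rintro _ ⟨i, rfl⟩
      exact (killS_X K _ _).2 (Finset.mem_univ _)
    rw [h] at h2
    exact (killS_prime K (Finset.univ : Finset (Fin 3 × Fin (m + 2)))).ne_top (top_le_iff.1 h2)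
  refine (idealHeight_eq _).trans ((Ideal.height_mono hle).trans ?_)
  obtain ⟨p, hp⟩ := Ideal.nonempty_minimalPrimes hne
  have hpp : p.IsPrime := hp.1.1
  refine (Ideal.height_mono hp.1.2).trans ?_
  have hp' : p ∈ (Ideal.span ((Finset.univ.image g : Finset (PR K (m + 2))) : Set _)).minimalPrimes := by
    simpa using hp
  refine (Ideal.height_le_card_of_mem_minimalPrimes_span_finset hp').trans ?_
  have : (Finset.univ.image g).card ≤ m := Finset.card_image_le.trans (by simp)
  exact_mod_cast this

lemma lower (K : Type) [Field K] (m : ℕ) : (m : ℕ∞) ≤ idealHeight (Mn K (m + 2)) := by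
  classical
  refine le_iInf₂ fun p hp => ?_
  have hpp := p.2
  have key : ∀ i : Fin m, ∃ c : Fin 3, (X (c, ⟨i + c, by omega⟩) : PR K (m + 2)) ∈ p.asIdeal := by
    intro i
    have h : xv K (m + 2) ⟨i, by omega⟩ * yv K (m + 2) ⟨i + 1, by omega⟩ *
        zv K (m + 2) ⟨i + 2, by omega⟩ ∈ p.asIdeal :=
      hp (Ideal.subset_span ⟨_, _, _, by simp [Fin.lt_def], by simp [Fin.lt_def], rfl⟩)
    rcases hpp.mem_or_mem h with h | h
    · rcases hpp.mem_or_mem h with h | h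
      · exact ⟨0, h⟩
      · exact ⟨1, h⟩
    · exact ⟨2, h⟩
  choose c hc using key
  set f : Fin m → Fin 3 × Fin (m + 2) := fun i => (c i, ⟨i + c i, by omega⟩)
  have hf : Function.Injective f := by
    intro i j hij
    simp only [f, Prod.mk.injEq, Fin.mk.injEq] at hij
    obtain ⟨h1, h2⟩ := hij
    rw [h1] at h2
    exact Fin.ext (by omega)
  have h1 := card_le_height_ker K (Finset.univ.image f)
  rw [Finset.card_image_of_injective _ hf, Finset.card_univ, Fintype.card_fin] at h1
  refine h1.trans ?_
  rw [← PrimeSpectrum.height_eq_orderHeight]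
  apply Ideal.height_mono
  apply ker_killS_le
  intro x hx
  obtain ⟨i, -, rfl⟩ := Finset.mem_image.1 hx
  exact hc i

/-- For `n ≥ 3`, the height of the diagonal matching field ideal `M_(n)` equals `n - 2`. -/
theorem stmt_5 (K : Type) [Field K] (n : ℕ) (hn : 3 ≤ n) :
    idealHeight (Mn K n) = (n : ℕ∞) - 2 := by
  obtain ⟨m, rfl⟩ : ∃ m, n = m + 2 := ⟨n - 2, by omega⟩
  have h : ((m + 2 : ℕ) : ℕ∞) - 2 = (m : ℕ∞) := by
    have : ((m + 2 - 2 : ℕ) : ℕ∞) = ((m + 2 : ℕ) : ℕ∞) - 2 := by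
      rw [ENat.natCast_sub]; rfl
    rw [← this]; simp
  rw [h]
  exact le_antisymm (upper K m) (lower K m)
end

section
/- Let n ≥ 3 and M_(n) = (x_i y_j z_k : 1 ≤ i < j < k ≤ n) ⊆ R = K[x_i,y_i,z_i : i ∈ [n]]. Then R/M_(n) is a Cohen–Macaulay ring. -/
open MvPolynomial

set_option synthInstance.maxHeartbeats 1000000
set_option maxHeartbeats 1000000

namespace DMF

open scoped Pointwise

/-- Ideal-theoretic weak regularity of a list on `R ⧸ I`. -/
def WR {R : Type} [CommRing R] : Ideal R → List R → Prop
  | _, [] => True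
  | I, r :: rs => (∀ f, r * f ∈ I → f ∈ I) ∧ WR (I ⊔ Ideal.span {r}) rs

lemma mem_sup_span {R : Type} [CommRing R] {I : Ideal R} {r f : R} :
    f ∈ I ⊔ Ideal.span {r} ↔ ∃ i ∈ I, ∃ g, f = i + r * g := by
  rw [Submodule.mem_sup]
  constructor
  · rintro ⟨i, hi, z, hz, rfl⟩
    obtain ⟨g, rfl⟩ := Ideal.mem_span_singleton'.1 hz
    exact ⟨i, hi, g, by ring⟩
  · rintro ⟨i, hi, g, rfl⟩
    exact ⟨i, hi, r * g, Ideal.mul_mem_right _ _ (Ideal.mem_span_singleton_self r), rfl⟩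

lemma WR.isWeaklyRegular {R : Type} [CommRing R] (rs : List R) : ∀ (I : Ideal R), WR I rs →
    RingTheory.Sequence.IsWeaklyRegular (R ⧸ I) rs := by
  induction rs with
  | nil => intro I _; exact RingTheory.Sequence.IsWeaklyRegular.nil R _
  | cons r rs ih =>
    intro I h
    obtain ⟨h1, h2⟩ := h
    refine RingTheory.Sequence.IsWeaklyRegular.cons ?_ ?_
    · rw [isSMulRegular_iff_right_eq_zero_of_smul]
      intro x hx
      obtain ⟨f, rfl⟩ := Ideal.Quotient.mk_surjective x
      have : Ideal.Quotient.mk I (r * f) = 0 := hx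
      rw [Ideal.Quotient.eq_zero_iff_mem] at this ⊢
      exact h1 f this
    · have e : ((r • ⊤ : Submodule R (R ⧸ I))) =
          Submodule.map (Submodule.mkQ I) (Ideal.span {r}) := by
        ext x
        obtain ⟨f, rfl⟩ := Submodule.mkQ_surjective I x
        rw [Submodule.mem_smul_pointwise_iff_exists, Submodule.mem_map]
        constructor
        · rintro ⟨b, -, hb⟩
          obtain ⟨g, rfl⟩ := Submodule.mkQ_surjective I b
          exact ⟨r * g, Ideal.mul_mem_right _ _ (Ideal.mem_span_singleton_self r), hb⟩
        · rintro ⟨b, hb, hb'⟩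
          obtain ⟨g, rfl⟩ := Ideal.mem_span_singleton'.1 hb
          exact ⟨Submodule.mkQ I g, trivial, by rw [← hb', mul_comm]; rfl⟩
      have e2 : QuotSMulTop r (R ⧸ I) ≃ₗ[R] (R ⧸ (I ⊔ Ideal.span {r})) :=
        (Submodule.quotEquivOfEq _ _ e).trans
          (Submodule.quotientQuotientEquivQuotientSup I (Ideal.span {r}))
      exact (e2.isWeaklyRegular_congr rs).2 (ih _ h2)

lemma WR.ext {R : Type} [CommRing R] (x : R) (rs : List R) : ∀ (I J : Ideal R),
    (∀ f ∈ J, x * f ∈ I) → (∀ f, x * f ∈ I → f ∈ J) → WR J rs → WR (I ⊔ Ideal.span {x}) rs →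
    WR I rs := by
  induction rs with
  | nil => intros; trivial
  | cons r rs ih =>
    intro I J h1 h2 hJ hI
    obtain ⟨a1, a2⟩ := hJ
    obtain ⟨b1, b2⟩ := hI
    refine ⟨?_, ih (I ⊔ Ideal.span {r}) (J ⊔ Ideal.span {r}) ?_ ?_ a2 ?_⟩
    · intro f hf
      obtain ⟨i, hi, g, rfl⟩ := mem_sup_span.1 (b1 f (Ideal.mem_sup_left hf))
      refine I.add_mem hi (h1 _ (a1 _ (h2 _ ?_)))
      have := I.sub_mem hf (I.mul_mem_left r hi)
      convert this using 1
      ring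
    · intro f hf
      obtain ⟨i, hi, g, rfl⟩ := mem_sup_span.1 hf
      exact mem_sup_span.2 ⟨x * i, h1 _ hi, x * g, by ring⟩
    · intro f hf
      obtain ⟨i, hi, g, hg⟩ := mem_sup_span.1 hf
      have : g ∈ I ⊔ Ideal.span {x} := by
        apply b1
        refine mem_sup_span.2 ⟨-i, I.neg_mem hi, f, ?_⟩
        rw [hg]; ring
      obtain ⟨j, hj, h, rfl⟩ := mem_sup_span.1 this
      refine mem_sup_span.2 ⟨f - r * h, h2 _ ?_, h, by ring⟩
      have := I.add_mem hi (I.mul_mem_left r hj)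
      convert this using 1
      linear_combination hg
    · rwa [sup_right_comm]

section poly
variable {σ : Type} {K : Type} [Field K]

lemma sub_mem_of_X (I : Ideal (MvPolynomial σ K)) (φ : MvPolynomial σ K →ₐ[K] MvPolynomial σ K)
    (h : ∀ v, X v - φ (X v) ∈ I) (f : MvPolynomial σ K) : f - φ f ∈ I := by
  have : (Ideal.Quotient.mkₐ K I) = (Ideal.Quotient.mkₐ K I).comp φ := by
    apply MvPolynomial.algHom_ext
    intro v
    exact Ideal.Quotient.eq.2 (h v)
  exact Ideal.Quotient.eq.1 (DFunLike.congr_fun this f)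

variable (K) in
/-- The ideal generated by a set of variables. -/
noncomputable def VI (V : Set σ) : Ideal (MvPolynomial σ K) := Ideal.span (X '' V)

lemma X_mem_VI {V : Set σ} {v : σ} (h : v ∈ V) : X v ∈ VI K V :=
  Ideal.subset_span ⟨v, h, rfl⟩

open Classical in
variable (K) in
noncomputable def kill (V : Set σ) : MvPolynomial σ K →ₐ[K] MvPolynomial σ K :=
  aeval (fun v => if v ∈ V then 0 else X v)

lemma mem_VI {V : Set σ} {f : MvPolynomial σ K} : f ∈ VI K V ↔ kill K V f = 0 := by
  constructor
  · intro h
    have : VI K V ≤ RingHom.ker (kill K V) := by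
      refine Ideal.span_le.2 ?_
      rintro _ ⟨v, hv, rfl⟩
      simp [kill, hv]
    exact this h
  · intro h
    have := sub_mem_of_X (VI K V) (kill K V) ?_ f
    · simpa [h] using this
    · intro v
      by_cases hv : v ∈ V
      · simpa [kill, hv] using X_mem_VI hv
      · simp [kill, hv]

lemma VI_reg {V : Set σ} {r f : MvPolynomial σ K} (hr : r ∉ VI K V) (h : r * f ∈ VI K V) :
    f ∈ VI K V := by
  rw [mem_VI] at *
  rw [map_mul] at h
  exact (mul_eq_zero.1 h).resolve_left hr

lemma X_not_mem {V : Set σ} {v : σ} (h : v ∉ V) : X v ∉ VI K V := by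
  rw [mem_VI]
  simp [kill, h]

lemma X_sub_not_mem {V : Set σ} {v w : σ} (h : v ∉ V) (hvw : v ≠ w) : X v - X w ∉ VI K V := by
  rw [mem_VI]
  by_cases hw : w ∈ V
  · simp [kill, h, hw]
  · simp [kill, h, hw, sub_eq_zero, X_injective.eq_iff, hvw]

lemma VI_insert (V : Set σ) (v : σ) : VI K V ⊔ Ideal.span {X v} = VI K (insert v V) := by
  rw [VI, VI, Set.image_insert_eq, Ideal.span_insert, sup_comm]

lemma span_sub {R : Type} [CommRing R] (I : Ideal R) {a b : R} (h : b ∈ I) :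
    I ⊔ Ideal.span {a - b} = I ⊔ Ideal.span {a} := by
  apply le_antisymm
  · refine sup_le le_sup_left ?_
    rw [Ideal.span_singleton_le_iff_mem]
    exact Ideal.sub_mem _ (Ideal.mem_sup_right (Ideal.mem_span_singleton_self _))
      (Ideal.mem_sup_left h)
  · refine sup_le le_sup_left ?_
    rw [Ideal.span_singleton_le_iff_mem]
    have := Ideal.add_mem _ (Ideal.mem_sup_right (Ideal.mem_span_singleton_self (a - b)) : _ ∈ I ⊔ Ideal.span {a - b})
      (Ideal.mem_sup_left h)
    simpa using this

lemma span_sub' {R : Type} [CommRing R] (I : Ideal R) {a b : R} (h : a ∈ I) :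
    I ⊔ Ideal.span {a - b} = I ⊔ Ideal.span {b} := by
  rw [← Ideal.span_singleton_neg, neg_sub, span_sub I h]

lemma pair {V : Set σ} {a b c : σ} (rs : List (MvPolynomial σ K)) (hab : a ≠ b) (hac : a ≠ c)
    (hbc : b ≠ c)
    (h : (a ∈ V ∧ b ∉ V ∧ c ∉ V) ∨ (a ∉ V ∧ b ∈ V ∧ c ∉ V) ∨ (a ∉ V ∧ b ∉ V ∧ c ∈ V))
    (hrs : WR (VI K (V ∪ {a, b, c})) rs) :
    WR (VI K V) ((X a - X b) :: (X b - X c) :: rs) := by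
  classical
  rcases h with ⟨ha, hb, hc⟩ | ⟨ha, hb, hc⟩ | ⟨ha, hb, hc⟩
  · refine ⟨fun f => VI_reg ?_, ?_⟩
    · rw [← neg_mem_iff, neg_sub]
      exact X_sub_not_mem hb hab.symm
    rw [span_sub' _ (X_mem_VI ha), VI_insert]
    refine ⟨fun f => VI_reg ?_, ?_⟩
    · rw [← neg_mem_iff, neg_sub]
      exact X_sub_not_mem (by simp [hc, hbc.symm]) hbc.symm
    rw [span_sub' _ (X_mem_VI (by simp)), VI_insert]
    convert hrs using 2
    grind
  · refine ⟨fun f => VI_reg (X_sub_not_mem ha hab), ?_⟩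
    rw [span_sub _ (X_mem_VI hb), VI_insert]
    refine ⟨fun f => VI_reg ?_, ?_⟩
    · rw [← neg_mem_iff, neg_sub]
      exact X_sub_not_mem (by simp [hc, hac.symm]) hbc.symm
    rw [span_sub' _ (X_mem_VI (by simp [hb])), VI_insert]
    convert hrs using 2
    grind
  · refine ⟨fun f => VI_reg (X_sub_not_mem ha hab), ?_⟩
    let φ : MvPolynomial σ K →ₐ[K] MvPolynomial σ K :=
      aeval (fun v => if v = a then X b else X v)
    have hφ : ∀ f, f - φ f ∈ Ideal.span {(X a - X b : MvPolynomial σ K)} := by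
      apply sub_mem_of_X
      intro v
      by_cases hv : v = a
      · subst hv; simp [φ]
      · simp [φ, hv]
    have hV : ∀ f ∈ VI K V, φ f ∈ VI K V := by
      intro f hf
      have : VI K V ≤ (VI K V).comap φ := by
        refine Ideal.span_le.2 ?_
        rintro _ ⟨v, hv, rfl⟩
        have : v ≠ a := by rintro rfl; exact ha hv
        simpa [φ, this] using X_mem_VI hv
      exact this hf
    refine ⟨?_, ?_⟩
    · intro f hf
      obtain ⟨i, hi, g, hg⟩ := mem_sup_span.1 hf
      have h2 := congrArg φ hg
      have h3 : (X b - X c) * φ f = φ i := by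
        simpa [φ, hab.symm, hac.symm] using h2
      have h4 : φ f ∈ VI K V := VI_reg (X_sub_not_mem hb hbc) (h3 ▸ hV i hi)
      have := Ideal.add_mem _ (Ideal.mem_sup_left h4) (Ideal.mem_sup_right (hφ f))
      simpa using this
    · rw [sup_right_comm, span_sub _ (X_mem_VI hc), VI_insert, span_sub _ (X_mem_VI (by simp)),
        VI_insert]
      convert hrs using 2
      grind

lemma frees (F : List σ) : ∀ (V : Set σ), F.Nodup → (∀ v ∈ F, v ∉ V) →
    WR (VI K V) (F.map X) := by
  induction F with
  | nil => intros; trivial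
  | cons v F ih =>
    intro V h1 h2
    refine ⟨fun f => VI_reg (X_not_mem (h2 v (by simp))), ?_⟩
    rw [VI_insert]
    apply ih _ (List.nodup_cons.1 h1).2
    intro w hw
    have := h2 w (by simp [hw])
    have : w ≠ v := by rintro rfl; exact (List.nodup_cons.1 h1).1 hw
    simp [*]

/-- The linear system of parameters. -/
noncomputable def sop (K : Type) [Field K] {τ : Type} (a b c : τ → σ) (L : List τ) (F : List σ) :
    List (MvPolynomial σ K) :=
  L.flatMap (fun t => [X (a t) - X (b t), X (b t) - X (c t)]) ++ F.map X

/-- The three families are jointly injective. -/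
structure Good {τ : Type} (a b c : τ → σ) (F : List σ) : Prop where
  ia : Function.Injective a
  ib : Function.Injective b
  ic : Function.Injective c
  ab : ∀ i j, a i ≠ b j
  ac : ∀ i j, a i ≠ c j
  bc : ∀ i j, b i ≠ c j
  nd : F.Nodup
  fa : ∀ v ∈ F, ∀ i, v ≠ a i
  fb : ∀ v ∈ F, ∀ i, v ≠ b i
  fc : ∀ v ∈ F, ∀ i, v ≠ c i

lemma base {τ : Type} {a b c : τ → σ} {F : List σ} (G : Good a b c F) (L : List τ) :
    ∀ V : Set σ, L.Nodup → (∀ v ∈ F, v ∉ V) →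
    (∀ t ∈ L, (a t ∈ V ∧ b t ∉ V ∧ c t ∉ V) ∨ (a t ∉ V ∧ b t ∈ V ∧ c t ∉ V) ∨
      (a t ∉ V ∧ b t ∉ V ∧ c t ∈ V)) →
    WR (VI K V) (sop K a b c L F) := by
  induction L with
  | nil => intro V _ h _; exact frees F V G.nd h
  | cons t L ih =>
    intro V h1 h2 h3
    refine pair _ (G.ab _ _) (G.ac _ _) (G.bc _ _) (h3 t (by simp)) ?_
    refine ih _ (List.nodup_cons.1 h1).2 ?_ ?_
    · intro v hv
      simp [h2 v hv, G.fa v hv, G.fb v hv, G.fc v hv]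
    · intro s hs
      have hst : s ≠ t := by rintro rfl; exact (List.nodup_cons.1 h1).1 hs
      have := h3 s (by simp [hs])
      simpa [G.ab, G.ac, G.bc, fun i j => (G.ab i j).symm, fun i j => (G.ac i j).symm,
        fun i j => (G.bc i j).symm, G.ia.eq_iff, G.ib.eq_iff, G.ic.eq_iff, hst] using this

lemma X_reg_span (S : Set (σ →₀ ℕ)) (v : σ) (hS : ∀ s ∈ S, s v = 0) (f : MvPolynomial σ K)
    (h : X v * f ∈ Ideal.span ((fun s => monomial s (1 : K)) '' S)) :
    f ∈ Ideal.span ((fun s => monomial s (1 : K)) '' S) := by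
  classical
  rw [mem_ideal_span_monomial_image] at *
  intro m hm
  obtain ⟨s, hs, hle⟩ := h (Finsupp.single v 1 + m) (by
    rw [mem_support_iff, coeff_X_mul]
    exact mem_support_iff.1 hm)
  refine ⟨s, hs, fun w => ?_⟩
  by_cases hw : v = w
  · subst hw; simp [hS s hs]
  · simpa [Finsupp.single_apply, hw] using hle w


lemma X_reg_span' (G : Set (MvPolynomial σ K)) (v : σ)
    (hG : ∀ g ∈ G, ∃ s : σ →₀ ℕ, s v = 0 ∧ g = monomial s 1) (f : MvPolynomial σ K)
    (h : X v * f ∈ Ideal.span G) : f ∈ Ideal.span G := by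
  have : G = (fun s => monomial s (1 : K)) '' {s | s v = 0 ∧ monomial s (1 : K) ∈ G} := by
    ext g
    constructor
    · intro hg
      obtain ⟨s, hs, rfl⟩ := hG g hg
      exact ⟨s, ⟨hs, hg⟩, rfl⟩
    · rintro ⟨s, ⟨hs, hg⟩, rfl⟩
      exact hg
  rw [this] at h ⊢
  exact X_reg_span _ v (fun s hs => hs.1) f h

variable {m : ℕ}

/-- Generators of `M + (a_i : i < p)`. -/
def GA (K : Type) [Field K] (a b c : Fin m → σ) (p : ℕ) : Set (MvPolynomial σ K) :=
  {g | (∃ i : Fin m, i.1 < p ∧ g = X (a i)) ∨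
    (∃ i j k : Fin m, i ≤ j ∧ j ≤ k ∧ g = X (a i) * X (b j) * X (c k))}

/-- Generators of `(a_i : i < p) + (b_j : p ≤ j < q) + (b_j c_k : p ≤ j ≤ k)`. -/
def GB (K : Type) [Field K] (a b c : Fin m → σ) (p q : ℕ) : Set (MvPolynomial σ K) :=
  {g | (∃ i : Fin m, i.1 < p ∧ g = X (a i)) ∨
    (∃ j : Fin m, p ≤ j.1 ∧ j.1 < q ∧ g = X (b j)) ∨
    (∃ j k : Fin m, p ≤ j.1 ∧ j ≤ k ∧ g = X (b j) * X (c k))}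

/-- Variables of the prime `(a_i : i < p) + (b_j : p ≤ j < q) + (c_k : q ≤ k)`. -/
def VC (a b c : Fin m → σ) (p q : ℕ) : Set σ :=
  {v | (∃ i : Fin m, i.1 < p ∧ v = a i) ∨
    (∃ j : Fin m, p ≤ j.1 ∧ j.1 < q ∧ v = b j) ∨
    (∃ k : Fin m, q ≤ k.1 ∧ v = c k)}

lemma wrC {a b c : Fin m → σ} {F : List σ} (G : Good a b c F) (p q : ℕ) (hpq : p ≤ q) :
    WR (VI K (VC a b c p q)) (sop K a b c (List.finRange m) F) := by
  apply base G _ _ (List.nodup_finRange m)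
  · rintro v hv (⟨i, -, h⟩ | ⟨i, -, -, h⟩ | ⟨i, -, h⟩)
    · exact G.fa v hv i h
    · exact G.fb v hv i h
    · exact G.fc v hv i h
  · intro t _
    have ha : a t ∈ VC a b c p q ↔ t.1 < p := by
      simp only [VC, Set.mem_ofPred_eq, G.ab, G.ac, G.ia.eq_iff]; grind
    have hb : b t ∈ VC a b c p q ↔ p ≤ t.1 ∧ t.1 < q := by
      simp only [VC, Set.mem_ofPred_eq, fun i j => (G.ab i j).symm, G.bc, G.ib.eq_iff]; grind
    have hc : c t ∈ VC a b c p q ↔ q ≤ t.1 := by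
      simp only [VC, Set.mem_ofPred_eq, fun i j => (G.ac i j).symm, fun i j => (G.bc i j).symm,
        G.ic.eq_iff]; grind
    rw [ha, hb, hc]
    omega

lemma GB_le_C (a b c : Fin m → σ) (p q : ℕ) :
    Ideal.span (GB K a b c p q) ≤ VI K (VC a b c p q) := by
  rw [Ideal.span_le]
  rintro _ (⟨i, h, rfl⟩ | ⟨j, h1, h2, rfl⟩ | ⟨j, k, h1, h2, rfl⟩)
  · exact X_mem_VI (Or.inl ⟨i, h, rfl⟩)
  · exact X_mem_VI (Or.inr (Or.inl ⟨j, h1, h2, rfl⟩))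
  · rcases lt_or_ge j.1 q with h | h
    · exact Ideal.mul_mem_right _ _ (X_mem_VI (Or.inr (Or.inl ⟨j, h1, h, rfl⟩)))
    · exact Ideal.mul_mem_left _ _ (X_mem_VI (Or.inr (Or.inr ⟨k, h.trans h2, rfl⟩)))

lemma mul_span {R : Type} [CommRing R] (S : Set R) (I : Ideal R) (x : R)
    (h : ∀ g ∈ S, x * g ∈ I) : ∀ f ∈ Ideal.span S, x * f ∈ I := by
  intro f hf
  induction hf using Submodule.span_induction with
  | mem y hy => exact h y hy
  | zero => simp
  | add y z _ _ hy hz => rw [mul_add]; exact I.add_mem hy hz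
  | smul r y _ hy =>
    have := I.mul_mem_left r hy
    rw [smul_eq_mul]
    convert this using 1
    ring

lemma wrB {a b c : Fin m → σ} {F : List σ} (G : Good a b c F) (p d : ℕ) : ∀ (q : ℕ),
    p ≤ q → q + d = m →
    WR (Ideal.span (GB K a b c p q)) (sop K a b c (List.finRange m) F) := by
  induction d with
  | zero =>
    intro q hpq hq
    have : Ideal.span (GB K a b c p q) = VI K (VC a b c p q) := by
      apply le_antisymm (GB_le_C a b c p q)
      refine Ideal.span_le.2 ?_
      rintro _ ⟨v, (⟨i, h, rfl⟩ | ⟨j, h1, h2, rfl⟩ | ⟨k, h1, rfl⟩), rfl⟩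
      · exact Ideal.subset_span (Or.inl ⟨i, h, rfl⟩)
      · exact Ideal.subset_span (Or.inr (Or.inl ⟨j, h1, h2, rfl⟩))
      · have := k.2; omega
    rw [this]
    exact wrC G p q hpq
  | succ d ih =>
    intro q hpq hq
    let t : Fin m := ⟨q, by omega⟩
    refine WR.ext (X (b t)) _ _ (VI K (VC a b c p q)) ?_ ?_ (wrC G p q hpq) ?_
    · refine mul_span _ _ _ ?_
      rintro _ ⟨v, (⟨i, h, rfl⟩ | ⟨j, h1, h2, rfl⟩ | ⟨k, h1, rfl⟩), rfl⟩
      · exact Ideal.mul_mem_left _ _ (Ideal.subset_span (Or.inl ⟨i, h, rfl⟩))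
      · exact Ideal.mul_mem_left _ _ (Ideal.subset_span (Or.inr (Or.inl ⟨j, h1, h2, rfl⟩)))
      · exact Ideal.subset_span (Or.inr (Or.inr ⟨t, k, hpq, h1, rfl⟩))
    · intro f hf
      refine VI_reg (X_not_mem ?_) (GB_le_C a b c p q hf)
      rintro (⟨i, h, e⟩ | ⟨j, h1, h2, e⟩ | ⟨k, h1, e⟩)
      · exact G.ab _ _ e.symm
      · have := congrArg Fin.val (G.ib e)
        simp only [t] at this
        omega
      · exact G.bc _ _ e
    · have : Ideal.span (GB K a b c p q) ⊔ Ideal.span {X (b t)} =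
          Ideal.span (GB K a b c p (q + 1)) := by
        rw [← Ideal.span_union]
        congr 1
        ext g
        constructor
        · rintro ((h | ⟨j, h1, h2, rfl⟩ | h) | rfl)
          · exact Or.inl h
          · exact Or.inr (Or.inl ⟨j, h1, by omega, rfl⟩)
          · exact Or.inr (Or.inr h)
          · exact Or.inr (Or.inl ⟨t, hpq, by simp [t], rfl⟩)
        · rintro (h | ⟨j, h1, h2, rfl⟩ | h)
          · exact Or.inl (Or.inl h)
          · rcases Nat.lt_succ_iff_lt_or_eq.1 h2 with h | h
            · exact Or.inl (Or.inr (Or.inl ⟨j, h1, h, rfl⟩))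
            · right
              have : j = t := Fin.ext h
              rw [this]; rfl
          · exact Or.inl (Or.inr (Or.inr h))
      rw [this]
      exact ih (q + 1) (by omega) (by omega)

lemma GA_le_B (a b c : Fin m → σ) (p : ℕ) :
    Ideal.span (GA K a b c p) ≤ Ideal.span (GB K a b c p p) := by
  rw [Ideal.span_le]
  rintro _ (⟨i, h, rfl⟩ | ⟨i, j, k, h1, h2, rfl⟩)
  · exact Ideal.subset_span (Or.inl ⟨i, h, rfl⟩)
  · rcases lt_or_ge i.1 p with h | h
    · rw [mul_assoc]
      exact Ideal.mul_mem_right _ _ (Ideal.subset_span (Or.inl ⟨i, h, rfl⟩))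
    · rw [mul_assoc]
      exact Ideal.mul_mem_left _ _ (Ideal.subset_span
        (Or.inr (Or.inr ⟨j, k, h.trans h1, h2, rfl⟩)))

lemma wrA {a b c : Fin m → σ} {F : List σ} (G : Good a b c F) (d : ℕ) : ∀ (p : ℕ),
    p + d = m →
    WR (Ideal.span (GA K a b c p)) (sop K a b c (List.finRange m) F) := by
  classical
  induction d with
  | zero =>
    intro p hp
    have : Ideal.span (GA K a b c p) = Ideal.span (GB K a b c p p) := by
      apply le_antisymm (GA_le_B a b c p)
      refine Ideal.span_le.2 ?_
      rintro _ (⟨i, h, rfl⟩ | ⟨j, h1, h2, rfl⟩ | ⟨j, k, h1, h2, rfl⟩)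
      · exact Ideal.subset_span (Or.inl ⟨i, h, rfl⟩)
      · omega
      · have := j.2; omega
    rw [this]
    exact wrB G p 0 p le_rfl hp
  | succ d ih =>
    intro p hp
    let t : Fin m := ⟨p, by omega⟩
    refine WR.ext (X (a t)) _ _ (Ideal.span (GB K a b c p p)) ?_ ?_
      (wrB G p (d + 1) p le_rfl hp) ?_
    · refine mul_span _ _ _ ?_
      rintro _ (⟨i, h, rfl⟩ | ⟨j, h1, h2, rfl⟩ | ⟨j, k, h1, h2, rfl⟩)
      · exact Ideal.mul_mem_left _ _ (Ideal.subset_span (Or.inl ⟨i, h, rfl⟩))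
      · omega
      · rw [← mul_assoc]
        exact Ideal.subset_span (Or.inr ⟨t, j, k, h1, h2, rfl⟩)
    · intro f hf
      refine X_reg_span' _ (a t) ?_ f (GA_le_B a b c p hf)
      rintro _ (⟨i, h, rfl⟩ | ⟨j, h1, h2, rfl⟩ | ⟨j, k, h1, h2, rfl⟩)
      · refine ⟨Finsupp.single (a i) 1, ?_, rfl⟩
        rw [Finsupp.single_apply, if_neg]
        intro e
        have := congrArg Fin.val (G.ia e)
        simp only [t] at this
        omega
      · omega
      · refine ⟨Finsupp.single (b j) 1 + Finsupp.single (c k) 1, ?_, ?_⟩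
        · rw [Finsupp.add_apply, Finsupp.single_apply, Finsupp.single_apply,
            if_neg (G.ab _ _).symm, if_neg (G.ac _ _).symm, add_zero]
        · rw [X, X, monomial_mul, one_mul]
    · have : Ideal.span (GA K a b c p) ⊔ Ideal.span {X (a t)} =
          Ideal.span (GA K a b c (p + 1)) := by
        rw [← Ideal.span_union]
        congr 1
        ext g
        constructor
        · rintro ((⟨j, h1, rfl⟩ | h) | rfl)
          · exact Or.inl ⟨j, by omega, rfl⟩
          · exact Or.inr h
          · exact Or.inl ⟨t, by simp [t], rfl⟩
        · rintro (⟨j, h2, rfl⟩ | h)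
          · rcases Nat.lt_succ_iff_lt_or_eq.1 h2 with h | h
            · exact Or.inl (Or.inl ⟨j, h, rfl⟩)
            · right
              have : j = t := Fin.ext h
              rw [this]; rfl
          · exact Or.inl (Or.inr h)
      rw [this]
      exact ih (p + 1) (by omega)

lemma dim_ge [Finite σ] (I : Ideal (MvPolynomial σ K)) (V : Set σ) (h : I ≤ VI K V) :
    ((Nat.card {v // v ∉ V} : ℕ) : WithBot ℕ∞) ≤ ringKrullDim (MvPolynomial σ K ⧸ I) := by
  classical
  let φ : MvPolynomial σ K →ₐ[K] MvPolynomial {v // v ∉ V} K :=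
    aeval (fun v => if hv : v ∈ V then 0 else X ⟨v, hv⟩)
  have hφ : ∀ f ∈ I, φ f = 0 := by
    intro f hf
    have : VI K V ≤ RingHom.ker φ := by
      refine Ideal.span_le.2 ?_
      rintro _ ⟨v, hv, rfl⟩
      simp [φ, hv]
    exact this (h hf)
  have hs : Function.Surjective φ := by
    intro f
    refine ⟨rename (fun v => v.1) f, ?_⟩
    have : φ.comp (rename (fun v : {v // v ∉ V} => v.1)) = AlgHom.id K _ := by
      apply MvPolynomial.algHom_ext
      rintro ⟨v, hv⟩
      simp [φ, hv]
    exact DFunLike.congr_fun this f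
  have := ringKrullDim_le_of_surjective (Ideal.Quotient.lift I φ.toRingHom hφ)
    (Ideal.Quotient.lift_surjective_of_surjective I hφ hs)
  simpa using this

lemma dim_VI_le [Finite σ] (V : Set σ) :
    ringKrullDim (MvPolynomial σ K ⧸ VI K V) ≤ ((Nat.card {v // v ∉ V} : ℕ) : WithBot ℕ∞) := by
  classical
  let ψ : MvPolynomial {v // v ∉ V} K →ₐ[K] (MvPolynomial σ K ⧸ VI K V) :=
    (Ideal.Quotient.mkₐ K (VI K V)).comp (rename (fun v => v.1))
  let φ : MvPolynomial σ K →ₐ[K] MvPolynomial {v // v ∉ V} K :=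
    aeval (fun v => if hv : v ∈ V then 0 else X ⟨v, hv⟩)
  have hs : Function.Surjective ψ := by
    intro f
    obtain ⟨f, rfl⟩ := Ideal.Quotient.mk_surjective f
    refine ⟨φ f, ?_⟩
    have : ψ.comp φ = Ideal.Quotient.mkₐ K (VI K V) := by
      apply MvPolynomial.algHom_ext
      intro v
      by_cases hv : v ∈ V
      · simpa [φ, hv] using (Ideal.Quotient.eq_zero_iff_mem.2 (X_mem_VI hv)).symm
      · simp [φ, hv, ψ]
    exact DFunLike.congr_fun this f
  have := ringKrullDim_le_of_surjective ψ.toRingHom hs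
  simpa using this

lemma dim_le [Finite σ] (I : Ideal (MvPolynomial σ K)) (N : ℕ)
    (h : ∀ P : Ideal (MvPolynomial σ K), P.IsPrime → I ≤ P → ∃ V : Set σ, VI K V ≤ P ∧
      Nat.card {v // v ∉ V} ≤ N) :
    ringKrullDim (MvPolynomial σ K ⧸ I) ≤ (N : WithBot ℕ∞) := by
  rw [ringKrullDim_quotient]
  refine iSup_le fun s => ?_
  obtain ⟨V, hV, hN⟩ := h s.head.1.asIdeal s.head.1.isPrime s.head.2
  have hmem : ∀ i, (s i).1 ∈ PrimeSpectrum.zeroLocus (VI K V : Set (MvPolynomial σ K)) := by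
    intro i
    have : s.head ≤ s i := s.head_le i
    exact fun x hx => this (hV hx)
  let s' : LTSeries (PrimeSpectrum.zeroLocus (VI K V : Set (MvPolynomial σ K))) :=
    LTSeries.mk s.length (fun i => ⟨(s i).1, hmem i⟩) (fun i j hij => s.strictMono hij)
  have h1 := Order.LTSeries.length_le_krullDim s'
  rw [← ringKrullDim_quotient] at h1
  calc (s.length : WithBot ℕ∞) ≤ _ := h1
    _ ≤ _ := dim_VI_le V
    _ ≤ _ := by exact_mod_cast hN

end poly

end DMF

namespace DMF

def va (m : ℕ) (t : Fin m) : Fin 3 × Fin (m + 2) := (0, ⟨t.1, by omega⟩)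
def vb (m : ℕ) (t : Fin m) : Fin 3 × Fin (m + 2) := (1, ⟨t.1 + 1, by omega⟩)
def vc (m : ℕ) (t : Fin m) : Fin 3 × Fin (m + 2) := (2, ⟨t.1 + 2, by omega⟩)
def vF (m : ℕ) : List (Fin 3 × Fin (m + 2)) :=
  [(0, ⟨m, by omega⟩), (0, ⟨m + 1, by omega⟩), (1, ⟨0, by omega⟩), (1, ⟨m + 1, by omega⟩),
    (2, ⟨0, by omega⟩), (2, ⟨1, by omega⟩)]

lemma good (m : ℕ) : Good (va m) (vb m) (vc m) (vF m) where
  ia i j h := by simp [va] at h; omega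
  ib i j h := by simp [vb] at h; omega
  ic i j h := by simp [vc] at h; omega
  ab i j h := by simp [va, vb] at h
  ac i j h := by simp [va, vc] at h
  bc i j h := by simp [vb, vc] at h
  nd := by simp [vF]
  fa v hv i h := by
    have := i.2
    subst h; simp [vF, va] at hv; omega
  fb v hv i h := by
    have := i.2
    subst h; simp [vF, vb] at hv; omega
  fc v hv i h := by
    have := i.2
    subst h; simp [vF, vc] at hv

lemma Mn_eq (K : Type) [Field K] (m : ℕ) :
    Mn K (m + 2) = Ideal.span (GA K (va m) (vb m) (vc m) 0) := by
  rw [Mn]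
  congr 1
  ext g
  constructor
  · rintro ⟨i, j, k, h1, h2, rfl⟩
    have hk := k.2
    rw [Fin.lt_def] at h1 h2
    refine Or.inr ⟨⟨i.1, by omega⟩, ⟨j.1 - 1, by omega⟩, ⟨k.1 - 2, by omega⟩, ?_, ?_, ?_⟩
    · rw [Fin.le_def]; simp only; omega
    · rw [Fin.le_def]; simp only; omega
    · have e1 : j.1 - 1 + 1 = j.1 := by omega
      have e2 : k.1 - 2 + 2 = k.1 := by omega
      simp only [xv, yv, zv, va, vb, vc, e1, e2]
  · rintro (⟨i, h, -⟩ | ⟨i, j, k, h1, h2, rfl⟩)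
    · omega
    · rw [Fin.le_def] at h1 h2
      refine ⟨⟨i.1, by omega⟩, ⟨j.1 + 1, by omega⟩, ⟨k.1 + 2, by omega⟩, ?_, ?_, rfl⟩
      · rw [Fin.lt_def]; simp only; omega
      · rw [Fin.lt_def]; simp only; omega

lemma card_compl (m : ℕ) (f : Fin m → Fin 3 × Fin (m + 2)) (hf : Function.Injective f) :
    Nat.card {v // v ∉ Set.range f} = 2 * m + 6 := by
  classical
  have h := Fintype.card_subtype_compl (fun v => v ∈ Set.range f)
  have h2 : Fintype.card {v // v ∈ Set.range f} = m := by
    rw [← Nat.card_eq_fintype_card]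
    exact (Nat.card_range_of_injective hf).trans (by simp)
  rw [Nat.card_eq_fintype_card, h, h2]
  simp
  omega

lemma dim_eq (K : Type) [Field K] (m : ℕ) :
    ringKrullDim (PR K (m + 2) ⧸ Mn K (m + 2)) = ((2 * m + 6 : ℕ) : WithBot ℕ∞) := by
  have G := good m
  apply le_antisymm
  · apply dim_le
    intro P hP hM
    have : ∀ t : Fin m, ∃ v, (v = va m t ∨ v = vb m t ∨ v = vc m t) ∧ (X v : PR K (m + 2)) ∈ P := by
      intro t
      have h : (X (va m t) * X (vb m t) * X (vc m t) : PR K (m + 2)) ∈ P := by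
        apply hM
        rw [Mn_eq]
        exact Ideal.subset_span (Or.inr ⟨t, t, t, le_rfl, le_rfl, rfl⟩)
      rcases hP.mem_or_mem h with h | h
      · rcases hP.mem_or_mem h with h | h
        · exact ⟨_, Or.inl rfl, h⟩
        · exact ⟨_, Or.inr (Or.inl rfl), h⟩
      · exact ⟨_, Or.inr (Or.inr rfl), h⟩
    choose f hf hfP using this
    refine ⟨Set.range f, ?_, (card_compl m f ?_).le⟩
    · refine Ideal.span_le.2 ?_
      rintro _ ⟨_, ⟨t, rfl⟩, rfl⟩
      exact hfP t
    · intro s t hst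
      rcases hf s with h1 | h1 | h1 <;> rcases hf t with h2 | h2 | h2 <;> rw [h1, h2] at hst
      · exact G.ia hst
      · exact absurd hst (G.ab _ _)
      · exact absurd hst (G.ac _ _)
      · exact absurd hst.symm (G.ab _ _)
      · exact G.ib hst
      · exact absurd hst (G.bc _ _)
      · exact absurd hst.symm (G.ac _ _)
      · exact absurd hst.symm (G.bc _ _)
      · exact G.ic hst
  · rw [← card_compl m (va m) G.ia]
    apply dim_ge
    rw [Mn_eq, Ideal.span_le]
    rintro _ (⟨i, h, -⟩ | ⟨i, j, k, h1, h2, rfl⟩)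
    · omega
    · rw [mul_assoc]
      exact Ideal.mul_mem_right _ _ (X_mem_VI ⟨i, rfl⟩)

lemma sop_mem {σ τ K : Type} [Field K] (a b c : τ → σ) (L : List τ) (F : List σ) :
    ∀ q ∈ sop K a b c L F, q ∈ VI K (Set.univ : Set σ) := by
  have hX : ∀ v : σ, (X v : MvPolynomial σ K) ∈ VI K (Set.univ : Set σ) :=
    fun v => X_mem_VI trivial
  intro q hq
  simp only [sop, List.mem_append, List.mem_flatMap, List.mem_map, List.mem_cons,
    List.not_mem_nil, or_false] at hq
  rcases hq with ⟨t, -, rfl | rfl⟩ | ⟨v, -, rfl⟩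
  · exact Ideal.sub_mem _ (hX _) (hX _)
  · exact Ideal.sub_mem _ (hX _) (hX _)
  · exact hX _

lemma sop_length {σ τ K : Type} [Field K] (a b c : τ → σ) (L : List τ) (F : List σ) :
    (sop K a b c L F).length = 2 * L.length + F.length := by
  simp [sop, List.length_flatMap, mul_comm]

end DMF

open DMF in
/-- For `n ≥ 3`, the ring `R/M_(n)` is Cohen–Macaulay.  For the standard graded
`K`-algebra `R/M_(n)` this is expressed by the graded characterization of
Cohen–Macaulayness: there is a regular sequence, consisting of elements of the
irrelevant maximal ideal (the ideal generated by the images of all the variables),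
whose length equals the Krull dimension of `R/M_(n)`. -/
theorem stmt_6 (K : Type) [Field K] (n : ℕ) (hn : 3 ≤ n) :
    ∃ rs : List (PR K n ⧸ Mn K n),
      (∀ q ∈ rs, q ∈ Ideal.span
        (Set.range (fun v : Fin 3 × Fin n => Ideal.Quotient.mk (Mn K n) (X v)))) ∧
      RingTheory.Sequence.IsRegular (PR K n ⧸ Mn K n) rs ∧
      (rs.length : WithBot (WithTop ℕ)) = ringKrullDim (PR K n ⧸ Mn K n) := by
  obtain ⟨m, rfl⟩ : ∃ m, n = m + 2 := ⟨n - 2, by omega⟩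
  have hspan : Ideal.span
      (Set.range (fun v : Fin 3 × Fin (m + 2) => Ideal.Quotient.mk (Mn K (m + 2)) (X v))) =
      (VI K Set.univ).map (Ideal.Quotient.mk (Mn K (m + 2))) := by
    rw [VI, Ideal.map_span, Set.image_univ, ← Set.range_comp]
    rfl
  have hmem : ∀ q ∈ (sop K (va m) (vb m) (vc m) (List.finRange m) (vF m)).map
      (algebraMap (PR K (m + 2)) (PR K (m + 2) ⧸ Mn K (m + 2))), q ∈ Ideal.span
      (Set.range (fun v : Fin 3 × Fin (m + 2) => Ideal.Quotient.mk (Mn K (m + 2)) (X v))) := by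
    intro q hq
    obtain ⟨p, hp, rfl⟩ := List.mem_map.1 hq
    rw [hspan]
    exact Ideal.mem_map_of_mem _ (sop_mem _ _ _ _ _ p hp)
  refine ⟨_, hmem, ⟨?_, ?_⟩, ?_⟩
  · rw [RingTheory.Sequence.isWeaklyRegular_map_algebraMap_iff]
    apply WR.isWeaklyRegular
    rw [Mn_eq]
    exact wrA (good m) m 0 (by omega)
  · intro htop
    have hle : Ideal.ofList ((sop K (va m) (vb m) (vc m) (List.finRange m) (vF m)).map
        (algebraMap (PR K (m + 2)) (PR K (m + 2) ⧸ Mn K (m + 2)))) ≤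
        (VI K Set.univ).map (Ideal.Quotient.mk (Mn K (m + 2))) := by
      rw [← hspan]
      exact Ideal.span_le.2 hmem
    have h1 : (1 : PR K (m + 2) ⧸ Mn K (m + 2)) ∈
        (VI K Set.univ).map (Ideal.Quotient.mk (Mn K (m + 2))) := by
      apply hle
      have : (1 : PR K (m + 2) ⧸ Mn K (m + 2)) ∈
        (⊤ : Submodule (PR K (m + 2) ⧸ Mn K (m + 2)) (PR K (m + 2) ⧸ Mn K (m + 2))) := trivial
      rw [htop] at this
      simpa using this
    have hM : Mn K (m + 2) ≤ VI K Set.univ := by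
      rw [Mn_eq, Ideal.span_le]
      rintro _ (⟨i, h, -⟩ | ⟨i, j, k, h1, h2, rfl⟩)
      · omega
      · exact Ideal.mul_mem_left _ _ (X_mem_VI trivial)
    obtain ⟨f, hf, hf1⟩ := (Ideal.mem_map_iff_of_surjective _
      Ideal.Quotient.mk_surjective).1 h1
    have h3 : f - 1 ∈ Mn K (m + 2) := Ideal.Quotient.eq.1 hf1
    have h4 : (1 : PR K (m + 2)) ∈ VI K Set.univ := by
      have := Ideal.sub_mem _ hf (hM h3)
      simpa using this
    rw [mem_VI, map_one] at h4
    exact one_ne_zero h4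
  · rw [dim_eq, List.length_map, sop_length]
    have e : 2 * (List.finRange m).length + (vF m).length = 2 * m + 6 := by simp [vF]
    rw [e]
    rfl
end

section
/- For any partition a of [n] and any integer ℓ ≥ 1, the power (M_a)^ℓ of the block diagonal matching field ideal has linear quotients: there exists an ordering m_1 < m_2 < ... < m_N of the minimal monomial generators of (M_a)^ℓ such that for every pair s < t there is an index u < t and a variable v with v · m_t = (variable v') · m_u for some variable v' dividing m_t, where v divides m_s / gcd(m_s, m_t); equivalently each colon ideal (m_1,...,m_{t-1}) : m_t is generated by variables. -/
open MvPolynomial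

/-- Linear quotients for an ordered list of generators: each colon ideal of the span of
the earlier generators by a later generator is generated by a subset of the variables. -/
def LinQuot {σ : Type} {K : Type} [Field K] (L : List (MvPolynomial σ K)) : Prop :=
  ∀ j : Fin L.length, ∃ S : Set σ,
    (Ideal.span {m | m ∈ L.take j.val}).colon (Ideal.span {L.get j}) =
      Ideal.span ((fun s => (X s : MvPolynomial σ K)) '' S)

/-- The matching field monomial of a 3-subset `{i < j < k}` for the partition with block
function `β` (a monotone surjection `Fin n → Fin r` whose fibers are the consecutive
blocks `B_1, …, B_r`): it is `x_j y_i z_k` when the first block meeting `{i,j,k}` meets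
it in exactly one element (equivalently `β i ≠ β j`), and `x_i y_j z_k` otherwise. -/
noncomputable def mfMono (K : Type) [Field K] {n r : ℕ} (β : Fin n → Fin r)
    (i j k : Fin n) : PR K n :=
  if β i = β j then xv K n i * yv K n j * zv K n k else xv K n j * yv K n i * zv K n k

/-- The block diagonal matching field ideal `M_a`. -/
noncomputable def Ma (K : Type) [Field K] {n r : ℕ} (β : Fin n → Fin r) : Ideal (PR K n) :=
  Ideal.span {m | ∃ i j k : Fin n, i < j ∧ j < k ∧ m = mfMono K β i j k}

namespace MF

abbrev Trip (n : ℕ) := Fin n × Fin n × Fin n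

/-- the triple `(p,q,c)` stands for the monomial `x_p y_q z_c`. -/
def Val {n r : ℕ} (β : Fin n → Fin r) (X : Trip n) : Prop :=
  (β X.2.1 < β X.1 ∨ (β X.1 = β X.2.1 ∧ X.1 < X.2.1)) ∧ X.1 < X.2.2 ∧ X.2.1 < X.2.2

noncomputable def ex1 {n : ℕ} (X : Trip n) : Fin 3 × Fin n →₀ ℕ :=
  Finsupp.single (0, X.1) 1 + Finsupp.single (1, X.2.1) 1 + Finsupp.single (2, X.2.2) 1

noncomputable def expo {n : ℕ} (F : Multiset (Trip n)) : Fin 3 × Fin n →₀ ℕ := (F.map ex1).sum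

noncomputable def cnt {n : ℕ} (P : Trip n → Prop) (F : Multiset (Trip n)) : ℕ :=
  @Multiset.countP _ P (Classical.decPred P) F

section cntlemmas
variable {n : ℕ} {P Q : Trip n → Prop} {F G : Multiset (Trip n)}

@[simp] lemma cnt_zero : cnt P 0 = 0 := by simp [cnt]

@[simp] lemma cnt_cons (X : Trip n) [Decidable (P X)] :
    cnt P (X ::ₘ F) = cnt P F + (if P X then 1 else 0) := by
  unfold cnt
  rw [Multiset.countP_cons]
  congr

lemma cnt_mono (h : ∀ X ∈ F, P X → Q X) : cnt P F ≤ cnt Q F := by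
  classical
  induction F using Multiset.induction_on with
  | empty => simp
  | cons X F ih =>
    have := ih (fun Y hY => h Y (Multiset.mem_cons_of_mem hY))
    have h2 := h X (Multiset.mem_cons_self X F)
    simp only [cnt_cons]
    split_ifs <;> first | omega | tauto

lemma cnt_congr (h : ∀ X ∈ F, (P X ↔ Q X)) : cnt P F = cnt Q F :=
  le_antisymm (cnt_mono fun X hX => (h X hX).1) (cnt_mono fun X hX => (h X hX).2)

lemma cnt_split (P Q : Trip n → Prop) (F : Multiset (Trip n)) :
    cnt P F = cnt (fun X => P X ∧ Q X) F + cnt (fun X => P X ∧ ¬ Q X) F := by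
  classical
  induction F using Multiset.induction_on with
  | empty => simp
  | cons X F ih =>
    simp only [cnt_cons]
    split_ifs <;> first | omega | tauto

lemma cnt_true : cnt (fun _ => True) F = Multiset.card F := by
  induction F using Multiset.induction_on with
  | empty => simp
  | cons X F ih => simp [ih]

lemma cnt_le_card : cnt P F ≤ Multiset.card F := by
  rw [← cnt_true]; exact cnt_mono (by simp)

lemma cnt_pos (h : 0 < cnt P F) : ∃ X ∈ F, P X := by
  let _ := Classical.decPred P
  unfold cnt at h
  exact Multiset.countP_pos.1 h

lemma cnt_fiber {κ : Type*} [Fintype κ] (f : Trip n → κ) (P : Trip n → Prop)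
    (F : Multiset (Trip n)) :
    cnt P F = ∑ k : κ, cnt (fun X => P X ∧ f X = k) F := by
  classical
  induction F using Multiset.induction_on with
  | empty => simp
  | cons X F ih =>
    simp only [cnt_cons, Finset.sum_add_distrib]
    rw [ih]
    congr 1
    by_cases h : P X <;> simp [h]

/-- coordinates -/
def co (k : Fin 3) (X : Trip n) : Fin n := if k = 0 then X.1 else if k = 1 then X.2.1 else X.2.2

@[simp] lemma expo_zero : expo (0 : Multiset (Trip n)) = 0 := rfl
@[simp] lemma expo_cons (X : Trip n) : expo (X ::ₘ F) = ex1 X + expo F := by simp [expo]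
lemma expo_add : expo (F + G) = expo F + expo G := by simp [expo]

open Classical in
lemma ex1_apply (X : Trip n) (k : Fin 3) (i : Fin n) :
    ex1 X (k, i) = if co k X = i then 1 else 0 := by
  fin_cases k <;> simp [ex1, co, Finsupp.single_apply]

open Classical in
lemma cnt_co (k : Fin 3) (P : Fin n → Prop) (F : Multiset (Trip n)) :
    cnt (fun X => P (co k X)) F = ∑ i, if P i then expo F (k, i) else 0 := by
  induction F using Multiset.induction_on with
  | empty => simp
  | cons X F ih =>
    have h : ∀ i, (if P i then expo (X ::ₘ F) (k, i) else 0)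
       = (if P i then expo F (k, i) else 0) + (if co k X = i then (if P i then 1 else 0) else 0) := by
      intro i
      rw [expo_cons, Finsupp.add_apply, ex1_apply]
      split_ifs <;> omega
    simp only [h, Finset.sum_add_distrib, cnt_cons, ih]
    simp

lemma cnt_co_le (k : Fin 3) (P : Fin n → Prop) (h : ∀ i, P i → expo F (k, i) ≤ expo G (k, i)) :
    cnt (fun X => P (co k X)) F ≤ cnt (fun X => P (co k X)) G := by
  classical
  rw [cnt_co, cnt_co]
  apply Finset.sum_le_sum
  intro i _
  by_cases hP : P i <;> simp [hP, h]

lemma cnt_co_eq (k : Fin 3) (P : Fin n → Prop) (h : ∀ i, P i → expo F (k, i) = expo G (k, i)) :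
    cnt (fun X => P (co k X)) F = cnt (fun X => P (co k X)) G :=
  le_antisymm (cnt_co_le k P fun i hi => (h i hi).le) (cnt_co_le k P fun i hi => (h i hi).ge)

lemma cnt_co_one (k : Fin 3) (i : Fin n) : cnt (fun X => co k X = i) F = expo F (k, i) := by
  classical
  refine (cnt_co k (fun j => j = i) F).trans ?_
  rw [Finset.sum_eq_single i]
  · exact if_pos rfl
  · intro b _ hb
    exact if_neg hb
  · simp

/-- if counts differ some exponent differs -/
lemma cnt_co_lt (k : Fin 3) (P : Fin n → Prop)
    (h : cnt (fun X => P (co k X)) F < cnt (fun X => P (co k X)) G) :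
    ∃ i, P i ∧ expo F (k, i) < expo G (k, i) := by
  by_contra hc
  push Not at hc
  have := cnt_co_le (F := G) (G := F) k P hc
  omega

lemma mem_of_expo_pos (k : Fin 3) (i : Fin n) (h : 0 < expo F (k, i)) :
    ∃ X ∈ F, co k X = i := by
  rw [← cnt_co_one] at h
  exact cnt_pos h

end cntlemmas

end MF

namespace MF

def T1 {n r : ℕ} (β : Fin n → Fin r) (h : Fin r) (X : Trip n) : Prop := β X.1 = h ∧ β X.2.1 = h
def T2 {n r : ℕ} (β : Fin n → Fin r) (h : Fin r) (X : Trip n) : Prop := β X.1 = h ∧ β X.2.1 < h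
def T3 {n r : ℕ} (β : Fin n → Fin r) (h : Fin r) (X : Trip n) : Prop := h < β X.1 ∧ β X.2.1 = h

def Gp {n r : ℕ} (β : Fin n → Fin r) (h : Fin r) (F : Multiset (Trip n)) (τ : Fin n) : Prop :=
  ∃ X ∈ F, T2 β h X ∧ X.1 < τ ∧ τ < X.2.2

def Zp {n r : ℕ} (β : Fin n → Fin r) (h : Fin r) (F : Multiset (Trip n))
    (HJ cut : Fin n → Prop) (q : Fin n) : Prop :=
  β q = h ∧ HJ q ∧ ¬ Gp β h F q ∧ ∀ e, cut e → e ≤ q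

def Endp {n r : ℕ} (β : Fin n → Fin r) (h : Fin r) (F : Multiset (Trip n))
    (cut : Fin n → Prop) (e : Fin n) : Prop :=
  (∃ X ∈ F, T2 β h X ∧ X.2.2 = e) ∨ cut e

open Classical in
noncomputable def lab {n r : ℕ} (β : Fin n → Fin r) (h : Fin r) (F : Multiset (Trip n))
    (cut : Fin n → Prop) (q : Fin n) : Finset (Fin n) :=
  Finset.univ.filter (fun e => Endp β h F cut e ∧ e ≤ q)

section master
variable {n r : ℕ} {β : Fin n → Fin r} {h : Fin r} {E F : Multiset (Trip n)}
  {HJ cut : Fin n → Prop}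

lemma fiber_le (hm : Monotone β) (hE : ∀ X ∈ E, Val β X) (hF : ∀ X ∈ F, Val β X)
    (hγ : ∀ X ∈ F, ∀ Y ∈ F, T1 β h X → T2 β h Y → Y.1 < X.2.1 → Y.1 ≤ X.1)
    (hβ : ∀ X ∈ F, ∀ Y ∈ F, T2 β h Y → ¬ T2 β h X → Y.2.2 < X.2.2 →
      Y.2.2 ≤ X.1 ∨ Y.2.2 ≤ X.2.1)
    (hδ : ∀ X ∈ F, T1 β h X → ∀ q, HJ q → X.1 < q → HJ X.2.1)
    (hcut : ∀ e, cut e → β e = h ∧ ∀ X ∈ F, ¬ T2 β h X → e < X.2.2 → e ≤ X.1 ∨ e ≤ X.2.1)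
    (hA : ∀ q, HJ q → ∀ p, p < q → expo E (0, p) = expo F (0, p))
    (hC : ∀ c, expo E (2, c) = expo F (2, c)) (S : Finset (Fin n)) :
    cnt (fun X => (T1 β h X ∧ Zp β h F HJ cut X.2.1) ∧ lab β h F cut X.2.1 = S) E ≤
    cnt (fun X => (T1 β h X ∧ Zp β h F HJ cut X.2.1) ∧ lab β h F cut X.2.1 = S) F := by
  classical
  by_cases hne : ∃ X ∈ E, (T1 β h X ∧ Zp β h F HJ cut X.2.1) ∧ lab β h F cut X.2.1 = S
  swap
  · have : ¬ 0 < cnt (fun X => (T1 β h X ∧ Zp β h F HJ cut X.2.1) ∧ lab β h F cut X.2.1 = S) E :=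
      fun hc => hne (cnt_pos hc)
    omega
  -- the maximal `q`
  obtain ⟨q, ⟨hZq, hlq⟩, hqmax⟩ : ∃ q, (Zp β h F HJ cut q ∧ lab β h F cut q = S) ∧
      ∀ X ∈ E, (T1 β h X ∧ Zp β h F HJ cut X.2.1) ∧ lab β h F cut X.2.1 = S → X.2.1 ≤ q := by
    obtain ⟨X0, hX0, hX0'⟩ := hne
    let s : Finset (Fin n) := Finset.univ.filter
      (fun q => Zp β h F HJ cut q ∧ lab β h F cut q = S)
    have hs : s.Nonempty := ⟨X0.2.1, by simp [s]; tauto⟩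
    refine ⟨s.max' hs, ?_, ?_⟩
    · have := s.max'_mem hs
      simpa [s] using this
    · intro X _ hX
      apply s.le_max'
      simp [s]; tauto
  obtain ⟨hqh, hqJ, hqG, hqc⟩ := hZq
  have hEnd : ∀ e, Endp β h F cut e → h ≤ β e := by
    rintro e (⟨X, hX, hT, rfl⟩ | hc)
    · rw [← hT.1]; exact hm (hF X hX).2.1.le
    · exact (hcut e hc).1.ge
  have hS : ∀ e, e ∈ S ↔ Endp β h F cut e ∧ e ≤ q := by
    intro e; rw [← hlq]; simp [lab]
  -- common: a T1 triple of F with p < q* whose q exceeds all ends in S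
  have key : ∀ X ∈ F, T1 β h X → X.1 < q → (∀ e ∈ S, e ≤ X.2.1) →
      (T1 β h X ∧ Zp β h F HJ cut X.2.1) ∧ lab β h F cut X.2.1 = S := by
    intro X hX hT hpq hle
    have hno : ∀ Y ∈ F, T2 β h Y → Y.1 < X.2.1 → Y.2.2 ≤ q := by
      intro Y hY hYT hlt
      have := hγ X hX Y hY hT hYT hlt
      by_contra hc
      exact hqG ⟨Y, hY, hYT, lt_of_le_of_lt this hpq, not_le.1 hc⟩
    refine ⟨⟨hT, hT.2, hδ X hX hT q hqJ hpq, ?_, ?_⟩, ?_⟩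
    · rintro ⟨Y, hY, hYT, h1, h2⟩
      have h3 := hno Y hY hYT h1
      have := hle Y.2.2 ((hS _).2 ⟨Or.inl ⟨Y, hY, hYT, rfl⟩, h3⟩)
      exact absurd this (not_le.2 h2)
    · intro e he
      exact hle e ((hS e).2 ⟨Or.inr he, hqc e he⟩)
    · ext e
      rw [hS]
      simp only [lab, Finset.mem_filter, Finset.mem_univ, true_and]
      constructor
      · rintro ⟨he, heq⟩
        refine ⟨he, ?_⟩
        rcases he with ⟨Y, hY, hYT, rfl⟩ | hc
        · exact hno Y hY hYT (lt_of_lt_of_le (hF Y hY).2.1 heq)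
        · exact hqc e hc
      · rintro ⟨he, heq⟩
        exact ⟨he, hle e ((hS e).2 ⟨he, heq⟩)⟩
  have hT2no : ∀ X ∈ F, T2 β h X → X.1 < q → X.2.2 ∈ S := by
    intro X hX hT hp
    by_contra hc
    apply hqG
    refine ⟨X, hX, hT, hp, ?_⟩
    by_contra h2
    exact hc ((hS _).2 ⟨Or.inl ⟨X, hX, hT, rfl⟩, not_lt.1 h2⟩)
  by_cases hSe : S.Nonempty
  · set κ := S.max' hSe with hκ
    have hκS : κ ∈ S := S.max'_mem hSe
    have hκE := (hS κ).1 hκS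
    have hβκ := hEnd κ hκE.1
    have hκle : ∀ e ∈ S, e ≤ κ := fun e he => S.le_max' e he
    have hκβ : ∀ X ∈ F, ¬ T2 β h X → κ < X.2.2 → κ ≤ X.1 ∨ κ ≤ X.2.1 := by
      intro X hX hT hlt
      rcases hκE.1 with ⟨Y, hY, hYT, hYe⟩ | hc
      · rw [← hYe] at hlt ⊢
        exact hβ X hX Y hY hYT hT hlt
      · exact (hcut κ hc).2 X hX hT hlt
    have e1 : cnt (fun X => (T1 β h X ∧ Zp β h F HJ cut X.2.1) ∧ lab β h F cut X.2.1 = S) E ≤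
        cnt (fun X => X.1 < q ∧ ¬ X.2.2 ≤ κ) E := by
      apply cnt_mono
      intro X hX hXX
      have h1 := hqmax X hX hXX
      obtain ⟨⟨hT, hZ⟩, hl⟩ := hXX
      have hv := hE X hX
      have hpq : X.1 < X.2.1 := by
        rcases hv.1 with h2 | h2
        · rw [hT.1, hT.2] at h2; exact absurd h2 (lt_irrefl _)
        · exact h2.2
      refine ⟨lt_of_lt_of_le hpq h1, ?_⟩
      have : κ ≤ X.2.1 := by
        rw [← hl] at hκS
        simp [lab] at hκS
        exact hκS.2
      exact not_le.2 (lt_of_le_of_lt this hv.2.2)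
    have hsp : ∀ D : Multiset (Trip n), (∀ X ∈ D, Val β X) →
        cnt (fun X => X.1 < q) D = cnt (fun X => X.2.2 ≤ κ) D
          + cnt (fun X => X.1 < q ∧ ¬ X.2.2 ≤ κ) D := by
      intro D hD
      rw [cnt_split (fun X => X.1 < q) (fun X => X.2.2 ≤ κ) D]
      congr 1
      apply cnt_congr
      intro X hX
      constructor
      · exact fun h => h.2
      · intro h1
        exact ⟨lt_of_lt_of_le (hD X hX).2.1 (h1.trans hκE.2), h1⟩
    have e2 := hsp E hE
    have e3 := hsp F hF
    have e4 : cnt (fun X => X.1 < q) E = cnt (fun X => X.1 < q) F :=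
      cnt_co_eq 0 (fun i => i < q) (fun i hi => hA q hqJ i hi)
    have e5 : cnt (fun X => X.2.2 ≤ κ) E = cnt (fun X => X.2.2 ≤ κ) F :=
      cnt_co_eq 2 (fun i => i ≤ κ) (fun i hi => hC i)
    have e6 : cnt (fun X => X.1 < q ∧ ¬ X.2.2 ≤ κ) F ≤
      cnt (fun X => (T1 β h X ∧ Zp β h F HJ cut X.2.1) ∧ lab β h F cut X.2.1 = S) F := by
      apply cnt_mono
      rintro X hX ⟨hp, hc⟩
      have hv := hF X hX
      have hnT2 : ¬ T2 β h X := fun hT => hc (hκle _ (hT2no X hX hT hp))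
      have h1 := hκβ X hX hnT2 (not_le.1 hc)
      have hpb : β X.1 ≤ h := by rw [← hqh]; exact hm hp.le
      have hqb : β X.2.1 ≤ β X.1 := by rcases hv.1 with h2 | h2; exacts [h2.le, h2.1.ge]
      have hpb' : β X.1 = h := by
        apply le_antisymm hpb
        rcases h1 with h2 | h2
        · exact hβκ.trans (hm h2)
        · exact (hβκ.trans (hm h2)).trans hqb
      have hqb' : β X.2.1 = h := by
        by_contra hne
        exact hnT2 ⟨hpb', lt_of_le_of_ne (hqb.trans hpb) hne⟩
      have hpq : X.1 < X.2.1 := by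
        rcases hv.1 with h2 | h2
        · rw [hpb', hqb'] at h2; exact absurd h2 (lt_irrefl _)
        · exact h2.2
      refine key X hX ⟨hpb', hqb'⟩ hp ?_
      intro e he
      refine (hκle e he).trans ?_
      rcases h1 with h2 | h2
      exacts [h2.trans hpq.le, h2]
    omega
  · have hS0 : S = ∅ := Finset.not_nonempty_iff_eq_empty.1 hSe
    calc _ ≤ cnt (fun X => β X.1 = h ∧ X.1 < q) E := by
          apply cnt_mono
          intro X hX hXX
          have h1 := hqmax X hX hXX
          obtain ⟨⟨hT, hZ⟩, hl⟩ := hXX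
          have hv := hE X hX
          have hpq : X.1 < X.2.1 := by
            rcases hv.1 with h2 | h2
            · rw [hT.1, hT.2] at h2; exact absurd h2 (lt_irrefl _)
            · exact h2.2
          exact ⟨hT.1, lt_of_lt_of_le hpq h1⟩
      _ = cnt (fun X => β X.1 = h ∧ X.1 < q) F :=
          cnt_co_eq 0 (fun i => β i = h ∧ i < q) (fun i hi => hA q hqJ i hi.2)
      _ ≤ _ := by
          apply cnt_mono
          rintro X hX ⟨hb, hp⟩
          have hv := hF X hX
          have hnT2 : ¬ T2 β h X := fun hT => by
            have := hT2no X hX hT hp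
            simp [hS0] at this
          have hqb : β X.2.1 ≤ β X.1 := by rcases hv.1 with h2 | h2; exacts [h2.le, h2.1.ge]
          have hqb' : β X.2.1 = h := by
            by_contra hne
            exact hnT2 ⟨hb, lt_of_le_of_ne (hb ▸ hqb) hne⟩
          exact key X hX ⟨hb, hqb'⟩ hp (by simp [hS0])

lemma master (hm : Monotone β) (hE : ∀ X ∈ E, Val β X) (hF : ∀ X ∈ F, Val β X)
    (hγ : ∀ X ∈ F, ∀ Y ∈ F, T1 β h X → T2 β h Y → Y.1 < X.2.1 → Y.1 ≤ X.1)
    (hβ : ∀ X ∈ F, ∀ Y ∈ F, T2 β h Y → ¬ T2 β h X → Y.2.2 < X.2.2 →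
      Y.2.2 ≤ X.1 ∨ Y.2.2 ≤ X.2.1)
    (hδ : ∀ X ∈ F, T1 β h X → ∀ q, HJ q → X.1 < q → HJ X.2.1)
    (hcut : ∀ e, cut e → β e = h ∧ ∀ X ∈ F, ¬ T2 β h X → e < X.2.2 → e ≤ X.1 ∨ e ≤ X.2.1)
    (hA : ∀ q, HJ q → ∀ p, p < q → expo E (0, p) = expo F (0, p))
    (hC : ∀ c, expo E (2, c) = expo F (2, c))
    (hT1 : ∀ X ∈ F, β X.2.1 = h → ¬ Zp β h F HJ cut X.2.1 → T1 β h X) :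
    cnt (T1 β h) E + cnt (fun X => β X.2.1 = h ∧ ¬ Zp β h F HJ cut X.2.1) F ≤
    cnt (T1 β h) F + cnt (fun X => β X.2.1 = h ∧ ¬ Zp β h F HJ cut X.2.1) E := by
  have e1 : cnt (fun X => T1 β h X ∧ Zp β h F HJ cut X.2.1) E ≤
      cnt (fun X => T1 β h X ∧ Zp β h F HJ cut X.2.1) F := by
    rw [cnt_fiber (fun X => lab β h F cut X.2.1) _ E, cnt_fiber (fun X => lab β h F cut X.2.1) _ F]
    exact Finset.sum_le_sum fun S _ => fiber_le hm hE hF hγ hβ hδ hcut hA hC S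
  have e2 := cnt_split (T1 β h) (fun X => Zp β h F HJ cut X.2.1) E
  have e3 := cnt_split (T1 β h) (fun X => Zp β h F HJ cut X.2.1) F
  have e4 : cnt (fun X => T1 β h X ∧ ¬ Zp β h F HJ cut X.2.1) E ≤
      cnt (fun X => β X.2.1 = h ∧ ¬ Zp β h F HJ cut X.2.1) E :=
    cnt_mono fun X _ hX => ⟨hX.1.2, hX.2⟩
  have e5 : cnt (fun X => β X.2.1 = h ∧ ¬ Zp β h F HJ cut X.2.1) F ≤
      cnt (fun X => T1 β h X ∧ ¬ Zp β h F HJ cut X.2.1) F :=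
    cnt_mono fun X hX h => ⟨hT1 X hX h.1 h.2, h.2⟩
  omega

end master
end MF

namespace MF

noncomputable def ins {n r : ℕ} (β : Fin n → Fin r) (F : Multiset (Trip n)) : ℕ :=
  cnt (fun X => β X.1 = β X.2.1) F

def Fac {n r : ℕ} (β : Fin n → Fin r) (d : Fin 3 × Fin n →₀ ℕ) (F : Multiset (Trip n)) : Prop :=
  (∀ X ∈ F, Val β X) ∧ expo F = d

noncomputable def iota {n r : ℕ} (β : Fin n → Fin r) (d : Fin 3 × Fin n →₀ ℕ) : ℕ :=
  sSup {k | ∃ F, Fac β d F ∧ ins β F = k}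

noncomputable def bs {n r : ℕ} (β : Fin n → Fin r) (d : Fin 3 × Fin n →₀ ℕ) (s : Fin r) : ℕ :=
  ∑ q, if β q = s then d (1, q) else 0

/-- `u` comes strictly before `v` -/
def Better {n r : ℕ} (β : Fin n → Fin r) (u v : Fin 3 × Fin n →₀ ℕ) : Prop :=
  (∃ t, (∀ j, t < j → v (2, j) = u (2, j)) ∧ v (2, t) < u (2, t)) ∨
  (∀ j, v (2, j) = u (2, j)) ∧
  ((∃ h, (∀ s, s < h → bs β v s = bs β u s) ∧ bs β v h < bs β u h) ∨
   (∀ s, bs β v s = bs β u s) ∧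
   ((∃ t, (∀ j, j < t → v (0, j) = u (0, j)) ∧ v (0, t) < u (0, t)) ∨
    (∀ j, v (0, j) = u (0, j)) ∧
    (iota β v < iota β u ∨
     iota β v = iota β u ∧
      (∃ t, (∀ j, t < j → v (1, j) = u (1, j)) ∧ v (1, t) < u (1, t)))))

def Step {n r : ℕ} (β : Fin n → Fin r) (u v : Fin 3 × Fin n →₀ ℕ) : Prop :=
  ∃ w w' F', (∀ X ∈ F', Val β X) ∧ expo F' + Finsupp.single w' 1 = v + Finsupp.single w 1 ∧
    v w < u w ∧ Better β (expo F') v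

section basic
variable {n r : ℕ} {β : Fin n → Fin r} {F G : Multiset (Trip n)} {d u v : Fin 3 × Fin n →₀ ℕ}

lemma bs_expo (s : Fin r) : bs β (expo F) s = cnt (fun X => β X.2.1 = s) F := by
  classical
  refine Eq.trans ?_ (cnt_co 1 (fun i => β i = s) F).symm
  unfold bs
  apply Finset.sum_congr rfl
  intros
  congr

lemma bs_add (d e : Fin 3 × Fin n →₀ ℕ) (s : Fin r) :
    bs β (d + e) s = bs β d s + bs β e s := by
  unfold bs
  rw [← Finset.sum_add_distrib]
  apply Finset.sum_congr rfl
  intro i _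
  split_ifs <;> simp

lemma bs_single_ne (k : Fin 3) (hk : k ≠ 1) (i : Fin n) (s : Fin r) :
    bs β (Finsupp.single (k, i) 1) s = 0 := by
  unfold bs
  apply Finset.sum_eq_zero
  intro j _
  simp [hk]

lemma bs_single (i : Fin n) (s : Fin r) :
    bs β (Finsupp.single (1, i) 1) s = if β i = s then 1 else 0 := by
  unfold bs
  rw [Finset.sum_eq_single i]
  · simp
  · intro j _ hj
    simp [Ne.symm hj]
  · simp

lemma card_eq : Multiset.card F = ∑ i, expo F (0, i) := by
  classical
  rw [← cnt_true]
  refine (cnt_co 0 (fun _ => True) F).trans ?_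
  simp

lemma iota_bdd : BddAbove {k | ∃ F, Fac β d F ∧ ins β F = k} := by
  refine ⟨∑ i, d (0, i), ?_⟩
  rintro k ⟨F, hF, rfl⟩
  rw [← hF.2, ← card_eq]
  exact cnt_le_card

lemma le_iota (hF : Fac β d F) : ins β F ≤ iota β d := le_csSup iota_bdd ⟨F, hF, rfl⟩

lemma exists_iota (hF : Fac β d F) : ∃ F', Fac β d F' ∧ ins β F' = iota β d :=
  Nat.sSup_mem (s := {k | ∃ F, Fac β d F ∧ ins β F = k}) ⟨_, F, hF, rfl⟩ iota_bdd

lemma mv_apply {d' : Fin 3 × Fin n →₀ ℕ} {w w' : Fin 3 × Fin n}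
    (h : d' + Finsupp.single w' 1 = d + Finsupp.single w 1) (a : Fin 3 × Fin n) :
    d' a + (if w' = a then 1 else 0) = d a + (if w = a then 1 else 0) := by
  have := DFunLike.congr_fun h a
  simpa [Finsupp.single_apply] using this

lemma mv_ne {d' : Fin 3 × Fin n →₀ ℕ} {w w' : Fin 3 × Fin n}
    (h : d' + Finsupp.single w' 1 = d + Finsupp.single w 1) (a : Fin 3 × Fin n)
    (h1 : w' ≠ a) (h2 : w ≠ a) : d a = d' a := by
  have := mv_apply h a
  simp only [h1, h2, if_false] at this
  omega

lemma mv_gt {d' : Fin 3 × Fin n →₀ ℕ} {w w' : Fin 3 × Fin n}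
    (h : d' + Finsupp.single w' 1 = d + Finsupp.single w 1) (h1 : w' ≠ w) : d w < d' w := by
  have := mv_apply h w
  simp only [h1, if_false, if_true] at this
  omega

lemma mv_bs {d' : Fin 3 × Fin n →₀ ℕ} {k : Fin 3} {i t : Fin n} (hk : k ≠ 1)
    (h : d' + Finsupp.single (k, i) 1 = d + Finsupp.single (k, t) 1) (s : Fin r) :
    bs β d s = bs β d' s := by
  have := congrArg (fun e => bs β e s) h
  simp only [bs_add, bs_single_ne k hk] at this
  omega

lemma mv_bs1 {d' : Fin 3 × Fin n →₀ ℕ} {i t : Fin n}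
    (h : d' + Finsupp.single (1, i) 1 = d + Finsupp.single (1, t) 1) (s : Fin r) :
    bs β d' s + (if β i = s then 1 else 0) = bs β d s + (if β t = s then 1 else 0) := by
  have := congrArg (fun e => bs β e s) h
  simpa only [bs_add, bs_single] using this

lemma rep1 (hF : Fac β v F) {X X' : Trip n} (hX : X ∈ F) (hV : Val β X')
    {w w' : Fin 3 × Fin n} (h : ex1 X' + Finsupp.single w' 1 = ex1 X + Finsupp.single w 1) :
    ∃ F', (∀ X ∈ F', Val β X) ∧ expo F' + Finsupp.single w' 1 = v + Finsupp.single w 1 ∧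
      ins β F' + (if β X.1 = β X.2.1 then 1 else 0)
        = ins β F + (if β X'.1 = β X'.2.1 then 1 else 0) := by
  obtain ⟨R, rfl⟩ := Multiset.exists_cons_of_mem hX
  refine ⟨X' ::ₘ R, ?_, ?_, ?_⟩
  · intro Y hY
    rcases Multiset.mem_cons.1 hY with rfl | hY
    exacts [hV, hF.1 Y (Multiset.mem_cons_of_mem hY)]
  · rw [← hF.2, expo_cons, expo_cons, add_right_comm, h, add_right_comm]
  · simp only [ins, cnt_cons]; split_ifs <;> omega

lemma rep2 (hF : Fac β v F) {X Y X' Y' : Trip n} (hX : X ∈ F) (hY : Y ∈ F) (hne : X ≠ Y)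
    (hV : Val β X') (hV' : Val β Y') {w w' : Fin 3 × Fin n}
    (h : ex1 X' + ex1 Y' + Finsupp.single w' 1 = ex1 X + ex1 Y + Finsupp.single w 1) :
    ∃ F', (∀ X ∈ F', Val β X) ∧ expo F' + Finsupp.single w' 1 = v + Finsupp.single w 1 ∧
      ins β F' + (if β X.1 = β X.2.1 then 1 else 0) + (if β Y.1 = β Y.2.1 then 1 else 0)
        = ins β F + (if β X'.1 = β X'.2.1 then 1 else 0)
          + (if β Y'.1 = β Y'.2.1 then 1 else 0) := by
  obtain ⟨R, rfl⟩ := Multiset.exists_cons_of_mem hX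
  have hY2 : Y ∈ R := by
    rcases Multiset.mem_cons.1 hY with h | h
    exacts [absurd h.symm hne, h]
  obtain ⟨R, rfl⟩ := Multiset.exists_cons_of_mem hY2
  refine ⟨X' ::ₘ Y' ::ₘ R, ?_, ?_, ?_⟩
  · intro Z hZ
    rcases Multiset.mem_cons.1 hZ with rfl | hZ
    · exact hV
    rcases Multiset.mem_cons.1 hZ with rfl | hZ
    · exact hV'
    exact hF.1 Z (by simp [hZ])
  · rw [← hF.2]
    simp only [expo_cons]
    rw [← add_assoc, ← add_assoc, add_right_comm, h, add_right_comm]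
  · simp only [ins, cnt_cons]; split_ifs <;> omega

lemma step_C (hF : Fac β v F) {X : Trip n} (hX : X ∈ F) {t : Fin n} (hlt : X.2.2 < t)
    (hu : v (2, t) < u (2, t)) : Step β u v := by
  have hv := hF.1 X hX
  obtain ⟨F', h1, h2, -⟩ := rep1 (X' := (X.1, X.2.1, t)) (w := (2, t)) (w' := (2, X.2.2)) hF hX
    ⟨hv.1, hv.2.1.trans hlt, hv.2.2.trans hlt⟩ (by simp only [ex1]; abel)
  refine ⟨_, _, F', h1, h2, hu, Or.inl ⟨t, ?_, ?_⟩⟩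
  · intro j hj
    exact mv_ne h2 _ (by simp; exact (hlt.trans hj).ne) (by simp; exact hj.ne)
  · exact mv_gt h2 (by simp; exact hlt.ne)

lemma step_b (hm : Monotone β) (hF : Fac β v F) {X : Trip n} (hX : X ∈ F) {t : Fin n}
    (hlt : β t < β X.2.1) (hu : v (1, t) < u (1, t)) : Step β u v := by
  have hv := hF.1 X hX
  have htq : t < X.2.1 := hm.reflect_lt hlt
  obtain ⟨F', h1, h2, -⟩ := rep1 (X' := (X.1, t, X.2.2)) (w := (1, t)) (w' := (1, X.2.1)) hF hX
    ⟨Or.inl (by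
      rcases hv.1 with h | h
      · exact hlt.trans h
      · rw [h.1]; exact hlt), hv.2.1, htq.trans hv.2.2⟩ (by simp only [ex1]; abel)
  refine ⟨_, _, F', h1, h2, hu, Or.inr ⟨?_, Or.inl ⟨β t, ?_, ?_⟩⟩⟩
  · intro j
    exact mv_ne h2 _ (by simp) (by simp)
  · intro s hs
    have := mv_bs1 (β := β) h2 s
    rw [if_neg (hs.trans hlt).ne', if_neg hs.ne'] at this
    omega
  · have := mv_bs1 (β := β) h2 (β t)
    rw [if_neg hlt.ne', if_pos rfl] at this
    omega

lemma step_A (hF : Fac β v F) {X : Trip n} (hX : X ∈ F) {t : Fin n}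
    (hlt : t < X.1) (hV : Val β (t, X.2.1, X.2.2)) (hu : v (0, t) < u (0, t)) : Step β u v := by
  obtain ⟨F', h1, h2, -⟩ := rep1 (X' := (t, X.2.1, X.2.2)) (w := (0, t)) (w' := (0, X.1)) hF hX
    hV (by simp only [ex1]; abel)
  refine ⟨_, _, F', h1, h2, hu, Or.inr ⟨?_, Or.inr ⟨?_, Or.inl ⟨t, ?_, ?_⟩⟩⟩⟩
  · intro j
    exact mv_ne h2 _ (by simp) (by simp)
  · intro s
    exact mv_bs (by simp) h2 s
  · intro j hj
    exact mv_ne h2 _ (by simp; exact (hj.trans hlt).ne') (by simp; exact hj.ne')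
  · exact mv_gt h2 (by simp; exact hlt.ne')

lemma step_B {F' : Multiset (Trip n)} (h1 : ∀ X ∈ F', Val β X) {j t : Fin n}
    (h2 : expo F' + Finsupp.single (1, j) 1 = v + Finsupp.single (1, t) 1)
    (hjt : β j = β t) (hu : v (1, t) < u (1, t)) (hi : iota β v ≤ ins β F')
    (hor : iota β v < ins β F' ∨ j < t) : Step β u v := by
  have hle : ins β F' ≤ iota β (expo F') := le_iota ⟨h1, rfl⟩
  refine ⟨_, _, F', h1, h2, hu, Or.inr ⟨?_, Or.inr ⟨?_, Or.inr ⟨?_, ?_⟩⟩⟩⟩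
  · intro j
    exact mv_ne h2 _ (by simp) (by simp)
  · intro s
    have := mv_bs1 (β := β) h2 s
    rw [hjt] at this
    omega
  · intro j
    exact mv_ne h2 _ (by simp) (by simp)
  · rcases hi.lt_or_eq with h | h
    · left; omega
    rcases (hi.trans hle).lt_or_eq with h3 | h3
    · left; omega
    right
    refine ⟨h3, t, ?_, ?_⟩
    · have hlt : j < t := by
        rcases hor with h | h
        · omega
        · exact h
      intro k hk
      exact mv_ne h2 _ (by simp; exact (hlt.trans hk).ne) (by simp; exact hk.ne)
    · have hlt : j < t := by
        rcases hor with h | h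
        · omega
        · exact h
      exact mv_gt h2 (by simp; exact hlt.ne)

end basic
end MF

namespace MF

open Classical in
noncomputable def psi {n r : ℕ} (β : Fin n → Fin r) (h : Fin r) (X : Trip n) : ℕ :=
  if T2 β h X then X.2.2.val + (n - X.1.val) else if T3 β h X then X.2.1.val else 0

noncomputable def Psi {n r : ℕ} (β : Fin n → Fin r) (h : Fin r) (F : Multiset (Trip n)) : ℕ :=
  (F.map (psi β h)).sum

structure Ext {n r : ℕ} (β : Fin n → Fin r) (h : Fin r) (v : Fin 3 × Fin n →₀ ℕ)
    (F : Multiset (Trip n)) : Prop where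
  fac : Fac β v F
  hi : ins β F = iota β v
  hmax : ∀ F', Fac β v F' → ins β F' = iota β v → cnt (T1 β h) F' = cnt (T1 β h) F →
    Psi β h F' ≤ Psi β h F

section ext
variable {n r : ℕ} {β : Fin n → Fin r} {h : Fin r} {F F0 : Multiset (Trip n)}
  {v : Fin 3 × Fin n →₀ ℕ}

lemma Psi_le : Psi β h F ≤ 2 * n * Multiset.card F := by
  classical
  unfold Psi
  have := Multiset.sum_le_card_nsmul (F.map (psi β h)) (2 * n) (by
    intro x hx
    obtain ⟨X, _, rfl⟩ := Multiset.mem_map.1 hx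
    have h1 := X.1.isLt
    have h2 := X.2.1.isLt
    have h3 := X.2.2.isLt
    unfold psi
    split_ifs <;> omega)
  simpa [mul_comm] using this

lemma exists_ext (hF : Fac β v F0) (hi : ins β F0 = iota β v) :
    ∃ F, Ext β h v F ∧ cnt (T1 β h) F = cnt (T1 β h) F0 := by
  let s : Set ℕ := {k | ∃ F, (Fac β v F ∧ ins β F = iota β v ∧ cnt (T1 β h) F = cnt (T1 β h) F0) ∧
    Psi β h F = k}
  have hb : BddAbove s := by
    refine ⟨2 * n * ∑ i, v (0, i), ?_⟩
    rintro k ⟨F, ⟨hF, -, -⟩, rfl⟩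
    rw [← hF.2, ← card_eq]
    exact Psi_le
  obtain ⟨F, ⟨h1, h2, h3⟩, h4⟩ := Nat.sSup_mem (s := s) ⟨_, F0, ⟨hF, hi, rfl⟩, rfl⟩ hb
  refine ⟨F, ⟨h1, h2, ?_⟩, h3⟩
  intro F' a b c
  rw [h4]
  exact le_csSup hb ⟨F', ⟨a, b, c.trans h3⟩, rfl⟩

open Classical in
lemma swap (hF : Ext β h v F) {X Y X' Y' : Trip n} (hX : X ∈ F) (hY : Y ∈ F) (hne : X ≠ Y)
    (hV : Val β X') (hV' : Val β Y') (he : ex1 X' + ex1 Y' = ex1 X + ex1 Y) :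
    ((if β X'.1 = β X'.2.1 then 1 else 0) + (if β Y'.1 = β Y'.2.1 then 1 else 0) ≤
      (if β X.1 = β X.2.1 then 1 else 0) + (if β Y.1 = β Y.2.1 then 1 else 0)) ∧
    (((if β X'.1 = β X'.2.1 then 1 else 0) + (if β Y'.1 = β Y'.2.1 then 1 else 0) =
      (if β X.1 = β X.2.1 then 1 else 0) + (if β Y.1 = β Y.2.1 then 1 else 0)) →
      ((if T1 β h X' then 1 else 0) + (if T1 β h Y' then 1 else 0) =
      (if T1 β h X then 1 else 0) + (if T1 β h Y then 1 else 0)) →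
      psi β h X' + psi β h Y' ≤ psi β h X + psi β h Y) := by
  obtain ⟨R, rfl⟩ := Multiset.exists_cons_of_mem hX
  have hY2 : Y ∈ R := by
    rcases Multiset.mem_cons.1 hY with h | h
    exacts [absurd h.symm hne, h]
  obtain ⟨R, rfl⟩ := Multiset.exists_cons_of_mem hY2
  have hfac : Fac β v (X' ::ₘ Y' ::ₘ R) := by
    refine ⟨?_, ?_⟩
    · intro Z hZ
      rcases Multiset.mem_cons.1 hZ with rfl | hZ
      · exact hV
      rcases Multiset.mem_cons.1 hZ with rfl | hZ
      · exact hV'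
      exact hF.fac.1 Z (by simp [hZ])
    · rw [← hF.fac.2]
      simp only [expo_cons]
      rw [← add_assoc, he, add_assoc]
  have h1 := le_iota hfac
  have h2 := hF.hi
  have h3 := hF.hmax _ hfac
  rw [← h2] at h1 h3
  simp only [ins, cnt_cons, Psi, Multiset.map_cons, Multiset.sum_cons] at h1 h3
  constructor
  · omega
  · intro a b
    have := h3 (by omega) (by omega)
    omega

lemma psi_T2 {X : Trip n} (hX : T2 β h X) : psi β h X = X.2.2.val + (n - X.1.val) := by
  simp [psi, hX]

lemma psi_T3 {X : Trip n} (hX : T3 β h X) : psi β h X = X.2.1.val := by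
  have : ¬ T2 β h X := fun h2 => absurd hX.1 (by rw [h2.1]; exact lt_irrefl _)
  simp [psi, hX, this]

lemma psi_T1 {X : Trip n} (hX : T1 β h X) : psi β h X = 0 := by
  have h2 : ¬ T2 β h X := fun h2 => absurd h2.2 (by rw [hX.2]; exact lt_irrefl _)
  have h3 : ¬ T3 β h X := fun h2 => absurd h2.1 (by rw [hX.1]; exact lt_irrefl _)
  simp [psi, h2, h3]

lemma T1_lt {X : Trip n} (hv : Val β X) (hX : T1 β h X) : X.1 < X.2.1 := by
  rcases hv.1 with h2 | h2
  · rw [hX.1, hX.2] at h2; exact absurd h2 (lt_irrefl _)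
  · exact h2.2

lemma ext_beta (hF : Ext β h v F) : ∀ X ∈ F, ∀ Y ∈ F, T2 β h Y → ¬ T2 β h X → Y.2.2 < X.2.2 →
      Y.2.2 ≤ X.1 ∨ Y.2.2 ≤ X.2.1 := by
  intro X hX Y hY hYT hXT hlt
  by_contra hc
  push Not at hc
  have vX := hF.fac.1 X hX
  have vY := hF.fac.1 Y hY
  have := (swap hF hX hY (by rintro rfl; exact hXT hYT)
    (X' := (X.1, X.2.1, Y.2.2)) (Y' := (Y.1, Y.2.1, X.2.2))
    ⟨vX.1, hc.1, hc.2⟩ ⟨vY.1, vY.2.1.trans hlt, vY.2.2.trans hlt⟩ (by simp only [ex1]; abel)).2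
    (by simp) (by unfold T1; congr)
  have hY' : T2 β h (Y.1, Y.2.1, X.2.2) := hYT
  have hX' : psi β h (X.1, X.2.1, Y.2.2) = psi β h X := by
    have : ¬ T2 β h (X.1, X.2.1, Y.2.2) := hXT
    have h3 : T3 β h (X.1, X.2.1, Y.2.2) ↔ T3 β h X := Iff.rfl
    unfold psi
    rw [if_neg this, if_neg hXT]
    by_cases hh : T3 β h X
    · rw [if_pos hh, if_pos (h3.2 hh)]
    · rw [if_neg hh, if_neg (mt h3.1 hh)]
  rw [psi_T2 hY', psi_T2 hYT, hX'] at this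
  simp only [Fin.lt_def] at hlt
  dsimp at this
  omega

lemma ext_gamma (hF : Ext β h v F) :
    ∀ X ∈ F, ∀ Y ∈ F, T1 β h X → T2 β h Y → Y.1 < X.2.1 → Y.1 ≤ X.1 := by
  intro X hX Y hY hXT hYT hlt
  by_contra hc
  push Not at hc
  have vX := hF.fac.1 X hX
  have vY := hF.fac.1 Y hY
  have hX' : T1 β h (Y.1, X.2.1, X.2.2) := ⟨hYT.1, hXT.2⟩
  have hY' : T2 β h (X.1, Y.2.1, Y.2.2) := ⟨hXT.1, hYT.2⟩
  have := (swap hF hX hY (by rintro rfl; exact hYT.2.ne hXT.2)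
    (X' := (Y.1, X.2.1, X.2.2)) (Y' := (X.1, Y.2.1, Y.2.2))
    ⟨Or.inr ⟨hYT.1.trans hXT.2.symm, hlt⟩, hlt.trans vX.2.2, vX.2.2⟩
    ⟨Or.inl (by rw [hXT.1]; exact hYT.2), hc.trans vY.2.1, vY.2.2⟩ (by simp only [ex1]; abel)).2
    (by simp [hYT.1, hXT.1, hXT.2]) (by simp [T1, hYT.1, hXT.1, hXT.2])
  rw [psi_T1 hX', psi_T2 hY', psi_T1 hXT, psi_T2 hYT] at this
  simp only [Fin.lt_def] at hc
  dsimp at this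
  have := Y.1.isLt
  omega

lemma ext_delta (hm : Monotone β) (hF : Ext β h v F) :
    ∀ X ∈ F, ∀ Y ∈ F, T1 β h X → T3 β h Y → X.1 < Y.2.1 → X.2.1 ≤ Y.2.1 := by
  intro X hX Y hY hXT hYT hlt
  by_contra hc
  push Not at hc
  have vX := hF.fac.1 X hX
  have vY := hF.fac.1 Y hY
  have hX' : T1 β h (X.1, Y.2.1, X.2.2) := ⟨hXT.1, hYT.2⟩
  have hY' : T3 β h (Y.1, X.2.1, Y.2.2) := ⟨hYT.1, hXT.2⟩
  have hqp : X.2.1 < Y.1 := hm.reflect_lt (by rw [hXT.2]; exact hYT.1)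
  have := (swap hF hX hY (by rintro rfl; exact hYT.1.ne' hXT.1)
    (X' := (X.1, Y.2.1, X.2.2)) (Y' := (Y.1, X.2.1, Y.2.2))
    ⟨Or.inr ⟨hXT.1.trans hYT.2.symm, hlt⟩, vX.2.1, hc.trans vX.2.2⟩
    ⟨Or.inl (by rw [hXT.2]; exact hYT.1), vY.2.1, hqp.trans vY.2.1⟩ (by simp only [ex1]; abel)).2
    (by simp [hYT.2, hXT.1, hXT.2]) (by simp [T1, hYT.2, hXT.1, hXT.2])
  rw [psi_T1 hX', psi_T3 hY', psi_T1 hXT, psi_T3 hYT] at this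
  simp only [Fin.lt_def] at hc
  dsimp at this
  omega

lemma ext_noT3 (hm : Monotone β) (hF : Ext β h v F) : ∀ Y ∈ F, T3 β h Y → ¬ Gp β h F Y.2.1 := by
  rintro Y hY hYT ⟨X, hX, hXT, h1, h2⟩
  have vX := hF.fac.1 X hX
  have vY := hF.fac.1 Y hY
  have hlt : β X.2.1 < β Y.1 := hXT.2.trans hYT.1
  have := (swap hF hX hY (by rintro rfl; exact hYT.1.ne' hXT.1)
    (X' := (X.1, Y.2.1, X.2.2)) (Y' := (Y.1, X.2.1, Y.2.2))
    ⟨Or.inr ⟨hXT.1.trans hYT.2.symm, h1⟩, vX.2.1, h2⟩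
    ⟨Or.inl hlt, vY.2.1, (hm.reflect_lt hlt).trans vY.2.1⟩ (by simp only [ex1]; abel)).1
  simp [hXT.1, hYT.2, hlt.ne', hXT.2.ne', hYT.1.ne'] at this

end ext
end MF

namespace MF

section cases
variable {n r : ℕ} {β : Fin n → Fin r} {h : Fin r} {E F : Multiset (Trip n)}
  {u v : Fin 3 × Fin n →₀ ℕ}

lemma cnt_co_strict (k : Fin 3) (P : Fin n → Prop) (t : Fin n) (ht : P t)
    (h : ∀ i, P i → expo F (k, i) ≤ expo E (k, i)) (hlt : expo F (k, t) < expo E (k, t)) :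
    cnt (fun X => P (co k X)) F < cnt (fun X => P (co k X)) E := by
  classical
  rw [cnt_co, cnt_co]
  apply Finset.sum_lt_sum
  · intro i _
    by_cases hP : P i <;> simp [hP, h]
  · exact ⟨t, Finset.mem_univ _, by simpa [ht] using hlt⟩

lemma cnt_blk (P : Fin r → Prop) (h : ∀ s, P s → bs β (expo F) s = bs β (expo E) s) :
    cnt (fun X => P (β X.2.1)) F = cnt (fun X => P (β X.2.1)) E := by
  rw [cnt_fiber (fun X => β X.2.1) _ F, cnt_fiber (fun X => β X.2.1) _ E]
  apply Finset.sum_congr rfl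
  intro s _
  by_cases hs : P s
  · have := h s hs
    rw [bs_expo, bs_expo] at this
    rw [cnt_congr (F := F) (Q := fun X => β X.2.1 = s),
      cnt_congr (F := E) (Q := fun X => β X.2.1 = s)]
    · exact this
    · intro X _
      constructor
      · exact fun h => h.2
      · exact fun h => ⟨h ▸ hs, h⟩
    · intro X _
      constructor
      · exact fun h => h.2
      · exact fun h => ⟨h ▸ hs, h⟩
  · have : ∀ D : Multiset (Trip n), cnt (fun X => P (β X.2.1) ∧ β X.2.1 = s) D = 0 := by
      intro D
      by_contra hc
      obtain ⟨X, _, h1, h2⟩ := cnt_pos (Nat.pos_of_ne_zero hc)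
      exact hs (h2 ▸ h1)
    rw [this, this]

lemma cnt_compl (P : Trip n → Prop) (F : Multiset (Trip n)) :
    Multiset.card F = cnt P F + cnt (fun X => ¬ P X) F := by
  rw [← cnt_true, cnt_split _ P F]
  simp

lemma caseC (hF : Fac β v F) (hu : expo E = u) (hc : Multiset.card E = Multiset.card F)
    (t : Fin n) (h1 : ∀ j, t < j → v (2, j) = u (2, j)) (h2 : v (2, t) < u (2, t)) :
    Step β u v := by
  subst hu
  obtain ⟨hv, rfl⟩ := hF
  have e1 : cnt (fun X => t ≤ X.2.2) F < cnt (fun X => t ≤ X.2.2) E :=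
    cnt_co_strict 2 (fun i => t ≤ i) t le_rfl (by
      intro i hi
      rcases hi.lt_or_eq with h | h
      · exact (h1 i h).le
      · subst h; exact h2.le) h2
  have e2 := cnt_compl (fun X => t ≤ X.2.2) F
  have e3 := cnt_compl (fun X => t ≤ X.2.2) E
  obtain ⟨X, hX, hXt⟩ := cnt_pos (P := fun X => ¬ t ≤ X.2.2) (F := F) (by omega)
  exact step_C ⟨hv, rfl⟩ hX (not_le.1 hXt) h2

lemma caseb (hm : Monotone β) (hF : Fac β v F) (hu : expo E = u)
    (hc : Multiset.card E = Multiset.card F)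
    (h : Fin r) (h1 : ∀ s, s < h → bs β v s = bs β u s) (h2 : bs β v h < bs β u h) :
    Step β u v := by
  subst hu
  obtain ⟨hv, rfl⟩ := hF
  have e1 := cnt_blk (β := β) (F := F) (E := E) (fun s => s < h) h1
  have h2' := h2
  rw [bs_expo, bs_expo] at h2'
  obtain ⟨t, ht, hlt⟩ := cnt_co_lt (F := F) (G := E) 1 (fun i => β i = h) h2'
  have e2 := cnt_compl (fun X => β X.2.1 ≤ h) F
  have e3 := cnt_compl (fun X => β X.2.1 ≤ h) E
  have e4 : ∀ D : Multiset (Trip n), cnt (fun X => β X.2.1 ≤ h) D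
      = cnt (fun X => β X.2.1 < h) D + cnt (fun X => β X.2.1 = h) D := by
    intro D
    rw [cnt_split (fun X => β X.2.1 ≤ h) (fun X => β X.2.1 < h) D]
    congr 1
    · exact cnt_congr fun X _ => ⟨fun a => a.2, fun a => ⟨a.le, a⟩⟩
    · exact cnt_congr fun X _ => ⟨fun a => le_antisymm a.1 (not_lt.1 a.2),
        fun a => ⟨a.le, a.ge.not_gt⟩⟩
  have e5 := e4 F
  have e6 := e4 E
  obtain ⟨X, hX, hXt⟩ := cnt_pos (P := fun X => ¬ β X.2.1 ≤ h) (F := F) (by omega)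
  exact step_b hm ⟨hv, rfl⟩ hX (ht ▸ not_le.1 hXt) hlt

lemma move2 (hm : Monotone β) (hF : Ext β h v F) {X Y : Trip n} (hX : X ∈ F) (hY : Y ∈ F)
    (hXT : T2 β h X) (hYT : T3 β h Y) {t : Fin n} (ht : β t = h) (h1 : X.1 < t) (h2 : t < X.2.2)
    (hu : v (1, t) < u (1, t)) : Step β u v := by
  have vX := hF.fac.1 X hX
  have vY := hF.fac.1 Y hY
  have hlt : β X.2.1 < β Y.1 := hXT.2.trans hYT.1
  obtain ⟨F', a1, a2, a3⟩ := rep2 hF.fac hX hY (by rintro rfl; exact hYT.1.ne' hXT.1)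
    (X' := (X.1, t, X.2.2)) (Y' := (Y.1, X.2.1, Y.2.2)) (w := (1, t)) (w' := (1, Y.2.1))
    ⟨Or.inr ⟨hXT.1.trans ht.symm, h1⟩, vX.2.1, h2⟩
    ⟨Or.inl hlt, vY.2.1, (hm.reflect_lt hlt).trans vY.2.1⟩ (by simp only [ex1]; abel)
  simp only [hXT.1, ht, hlt.ne', hXT.2.ne', hYT.2, hYT.1.ne', if_true, if_false] at a3
  have := hF.hi
  exact step_B a1 a2 (hYT.2.trans ht.symm) hu (by omega) (Or.inl (by omega))

lemma move3 (hm : Monotone β) (hF : Ext β h v F) {Y : Trip n} (hY : Y ∈ F)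
    (hYT : T3 β h Y) {t : Fin n} (ht : β t = h) (h1 : Y.2.1 < t)
    (hu : v (1, t) < u (1, t)) : Step β u v := by
  have vY := hF.fac.1 Y hY
  have hlt : β t < β Y.1 := by rw [ht]; exact hYT.1
  obtain ⟨F', a1, a2, a3⟩ := rep1 hF.fac hY
    (X' := (Y.1, t, Y.2.2)) (w := (1, t)) (w' := (1, Y.2.1))
    ⟨Or.inl hlt, vY.2.1, (hm.reflect_lt hlt).trans vY.2.1⟩ (by simp only [ex1]; abel)
  simp only [ht, hYT.2, hYT.1.ne', if_false] at a3
  have := hF.hi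
  exact step_B a1 a2 (hYT.2.trans ht.symm) hu (by omega) (Or.inr h1)

lemma val_le {X : Trip n} (hv : Val β X) : β X.2.1 ≤ β X.1 := by
  rcases hv.1 with h2 | h2; exacts [h2.le, h2.1.ge]

lemma T13 (hE : ∀ X ∈ E, Val β X) :
    cnt (fun X => β X.2.1 = h) E = cnt (T1 β h) E + cnt (T3 β h) E := by
  rw [cnt_split (fun X => β X.2.1 = h) (fun X => β X.1 = h) E]
  congr 1
  · exact cnt_congr fun X _ => ⟨fun a => ⟨a.2, a.1⟩, fun a => ⟨a.2, a.1⟩⟩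
  · refine cnt_congr fun X hX => ⟨fun a => ⟨?_, a.1⟩, fun a => ⟨a.2, a.1.ne'⟩⟩
    have := val_le (hE X hX)
    rw [a.1] at this
    exact lt_of_le_of_ne this (Ne.symm a.2)

lemma caseA (hm : Monotone β) (hF : Ext β h v F) (hE : Fac β u E)
    (hc : Multiset.card E = Multiset.card F) (hC : ∀ j, v (2, j) = u (2, j))
    (hb : ∀ s, bs β v s = bs β u s) (t : Fin n) (ht : β t = h)
    (h1 : ∀ j, j < t → v (0, j) = u (0, j)) (h2 : v (0, t) < u (0, t)) : Step β u v := by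
  classical
  by_contra hS
  have hFv := hF.fac.1
  have hFe := hF.fac.2
  have hEe := hE.2
  have noE3 : ∀ X ∈ F, β X.1 = h → X.1 ≤ t := by
    intro X hX hb
    by_contra hc
    push Not at hc
    have vX := hFv X hX
    refine hS (step_A hF.fac hX hc ⟨?_, hc.trans vX.2.1, vX.2.2⟩ h2)
    rcases vX.1 with a | a
    · left; dsimp only; rw [ht, ← hb]; exact a
    · right; dsimp only; rw [ht, ← hb]; exact ⟨a.1, hc.trans a.2⟩
  have noJ : ∀ X ∈ F, h < β X.1 → h ≤ β X.2.1 := by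
    intro X hX hlt
    by_contra hc
    push Not at hc
    have vX := hFv X hX
    have htX : t < X.1 := hm.reflect_lt (by rw [ht]; exact hlt)
    exact hS (step_A hF.fac hX htX ⟨Or.inl (by dsimp only; rw [ht]; exact hc),
      htX.trans vX.2.1, vX.2.2⟩ h2)
  have noT3 : ∀ X ∈ F, T3 β h X → X.2.1 ≤ t := by
    intro X hX hT
    by_contra hc
    push Not at hc
    have vX := hFv X hX
    have htX : t < X.1 := hm.reflect_lt (by rw [ht]; exact hT.1)
    exact hS (step_A hF.fac hX htX ⟨Or.inr ⟨by dsimp only; rw [ht, hT.2], hc⟩,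
      htX.trans vX.2.1, vX.2.2⟩ h2)
  have e1 : cnt (fun X => X.1 ≤ t) F < cnt (fun X => X.1 ≤ t) E :=
    cnt_co_strict 0 (fun i => i ≤ t) t le_rfl (by
      intro i hi
      rw [hFe, hEe]
      rcases hi.lt_or_eq with h | h
      · exact (h1 i h).le
      · rw [h]; exact h2.le) (by rw [hFe, hEe]; exact h2)
  have e2 : cnt (fun X => β X.1 ≤ h) F ≤ cnt (fun X => X.1 ≤ t) F := by
    apply cnt_mono
    intro X hX hle
    by_contra hc
    push Not at hc
    have : h ≤ β X.1 := by rw [← ht]; exact hm hc.le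
    exact absurd (noE3 X hX (le_antisymm hle this)) (not_le.2 hc)
  have e3 : cnt (fun X => X.1 ≤ t) E ≤ cnt (fun X => β X.1 ≤ h) E := by
    apply cnt_mono
    intro X hX hle
    rw [← ht]; exact hm hle
  have e4 := cnt_compl (fun X => β X.1 ≤ h) F
  have e5 := cnt_compl (fun X => β X.1 ≤ h) E
  have e6 := cnt_split (fun X => ¬ β X.1 ≤ h) (fun X => β X.2.1 = h) F
  have e7 := cnt_split (fun X => ¬ β X.1 ≤ h) (fun X => β X.2.1 = h) E
  have e8 : ∀ D : Multiset (Trip n),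
      cnt (fun X => ¬ β X.1 ≤ h ∧ β X.2.1 = h) D = cnt (T3 β h) D := fun D =>
    cnt_congr fun X _ => ⟨fun a => ⟨not_le.1 a.1, a.2⟩, fun a => ⟨not_le.2 a.1, a.2⟩⟩
  rw [e8] at e6 e7
  have e9 : cnt (fun X => ¬ β X.1 ≤ h ∧ ¬ β X.2.1 = h) F ≤ cnt (fun X => h < β X.2.1) F :=
    cnt_mono fun X hX a => lt_of_le_of_ne (noJ X hX (not_le.1 a.1)) (Ne.symm a.2)
  have e10 : cnt (fun X => h < β X.2.1) E ≤ cnt (fun X => ¬ β X.1 ≤ h ∧ ¬ β X.2.1 = h) E :=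
    cnt_mono fun X hX a => ⟨not_le.2 (lt_of_lt_of_le a (val_le (hE.1 X hX))), a.ne'⟩
  have hb' : ∀ s, bs β (expo F) s = bs β (expo E) s := by rw [hFe, hEe]; exact hb
  have e11 := cnt_blk (β := β) (F := F) (E := E) (fun s => h < s) (fun s _ => hb' s)
  have e12 := T13 (h := h) hFv
  have e13 := T13 (h := h) hE.1
  have e14 := cnt_blk (β := β) (F := F) (E := E) (fun s => s = h) (fun s _ => hb' s)
  obtain ⟨Y0, hY0, hY0T⟩ := cnt_pos (P := T3 β h) (F := F) (by omega)
  obtain ⟨Y, hY, hYmax⟩ := (F.toFinset.filter (T3 β h)).exists_max_image (fun X => X.2.1)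
    ⟨Y0, by simp [hY0, hY0T]⟩
  simp only [Finset.mem_filter, Multiset.mem_toFinset, and_imp] at hY hYmax
  obtain ⟨hYF, hYT⟩ := hY
  have hYt := noT3 Y hYF hYT
  have M := master (HJ := fun q => q ≤ Y.2.1) (cut := fun _ => False) hm hE.1 hFv
    (ext_gamma hF) (ext_beta hF)
    (fun X hX hT q hq hlt => ext_delta hm hF X hX Y hYF hT hYT (lt_of_lt_of_le hlt hq))
    (fun e he => he.elim)
    (fun q hq p hp => by
      rw [hFe, hEe]; exact (h1 p (lt_of_lt_of_le hp (le_trans hq hYt))).symm)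
    (fun c => by rw [hFe, hEe]; exact (hC c).symm)
    (fun X hX hq hZ => by
      by_contra hT
      have hT3 : T3 β h X := ⟨lt_of_le_of_ne (hq ▸ val_le (hFv X hX)) (fun a => hT ⟨a.symm, hq⟩), hq⟩
      exact hZ ⟨hq, hYmax X hX hT3, ext_noT3 hm hF X hX hT3, by simp⟩)
  have e15 : cnt (fun X => β X.2.1 = h ∧ ¬ Zp β h F (fun q => q ≤ Y.2.1) (fun _ => False) X.2.1) E
      ≤ cnt (fun X => β X.2.1 = h ∧ ¬ Zp β h F (fun q => q ≤ Y.2.1) (fun _ => False) X.2.1) F := by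
    refine cnt_co_le 1 (fun i => β i = h ∧ ¬ Zp β h F (fun q => q ≤ Y.2.1) (fun _ => False) i) ?_
    rintro i ⟨hi, hZ⟩
    rw [hFe, hEe]
    by_contra hc
    push Not at hc
    by_cases hiY : i ≤ Y.2.1
    · by_cases hG : Gp β h F i
      · obtain ⟨X, hX, hXT, a1, a2⟩ := hG
        exact hS (move2 hm hF hX hYF hXT hYT hi a1 a2 hc)
      · exact hZ ⟨hi, hiY, hG, by simp⟩
    · exact hS (move3 hm hF hYF hYT hi (not_le.1 hiY) hc)
  omega

lemma caseI (hm : Monotone β) (hF : Ext β h v F) (hE : Fac β u E)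
    (hC : ∀ j, v (2, j) = u (2, j)) (hb : ∀ s, bs β v s = bs β u s)
    (hA : ∀ j, v (0, j) = u (0, j)) (hlt : cnt (T1 β h) F < cnt (T1 β h) E) : Step β u v := by
  classical
  by_contra hS
  have hFv := hF.fac.1
  have hFe := hF.fac.2
  have hEe := hE.2
  have hb' : ∀ s, bs β (expo F) s = bs β (expo E) s := by rw [hFe, hEe]; exact hb
  have e12 := T13 (h := h) hFv
  have e13 := T13 (h := h) hE.1
  have e14 := cnt_blk (β := β) (F := F) (E := E) (fun s => s = h) (fun s _ => hb' s)
  obtain ⟨Y, hYF, hYT⟩ := cnt_pos (P := T3 β h) (F := F) (by omega)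
  have M := master (HJ := fun q => True) (cut := fun _ => False) hm hE.1 hFv
    (ext_gamma hF) (ext_beta hF)
    (fun X hX hT q hq hlt => trivial)
    (fun e he => he.elim)
    (fun q hq p hp => by rw [hFe, hEe]; exact (hA p).symm)
    (fun c => by rw [hFe, hEe]; exact (hC c).symm)
    (fun X hX hq hZ => by
      by_contra hT
      have hT3 : T3 β h X := ⟨lt_of_le_of_ne (hq ▸ val_le (hFv X hX)) (fun a => hT ⟨a.symm, hq⟩), hq⟩
      exact hZ ⟨hq, trivial, ext_noT3 hm hF X hX hT3, by simp⟩)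
  have e15 : cnt (fun X => β X.2.1 = h ∧ ¬ Zp β h F (fun q => True) (fun _ => False) X.2.1) E
      ≤ cnt (fun X => β X.2.1 = h ∧ ¬ Zp β h F (fun q => True) (fun _ => False) X.2.1) F := by
    refine cnt_co_le 1 (fun i => β i = h ∧ ¬ Zp β h F (fun q => True) (fun _ => False) i) ?_
    rintro i ⟨hi, hZ⟩
    rw [hFe, hEe]
    by_contra hc
    push Not at hc
    by_cases hG : Gp β h F i
    · obtain ⟨X, hX, hXT, a1, a2⟩ := hG
      exact hS (move2 hm hF hX hYF hXT hYT hi a1 a2 hc)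
    · exact hZ ⟨hi, trivial, hG, by simp⟩
  omega

lemma caseB (hm : Monotone β) (hF : Ext β h v F) (hE : Fac β u E)
    (hC : ∀ j, v (2, j) = u (2, j)) (hb : ∀ s, bs β v s = bs β u s)
    (hA : ∀ j, v (0, j) = u (0, j)) (heq : cnt (T1 β h) F = cnt (T1 β h) E)
    (t : Fin n) (ht : β t = h)
    (h1 : ∀ j, t < j → v (1, j) = u (1, j)) (h2 : v (1, t) < u (1, t)) : Step β u v := by
  classical
  by_contra hS
  have hFv := hF.fac.1
  have hFe := hF.fac.2
  have hEe := hE.2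
  have hFi := hF.hi
  have hb' : ∀ s, bs β (expo F) s = bs β (expo E) s := by rw [hFe, hEe]; exact hb
  have e14 := cnt_blk (β := β) (F := F) (E := E) (fun s => s = h) (fun s _ => hb' s)
  have e1 := cnt_split (fun X => β X.2.1 = h) (fun X => X.2.1 < t) F
  have e2 := cnt_split (fun X => β X.2.1 = h) (fun X => X.2.1 < t) E
  have e3 : cnt (fun X => β X.2.1 = h ∧ ¬ X.2.1 < t) F < cnt (fun X => β X.2.1 = h ∧ ¬ X.2.1 < t) E := by
    refine cnt_co_strict 1 (fun i => β i = h ∧ ¬ i < t) t ⟨ht, lt_irrefl _⟩ ?_ (by rw [hFe, hEe]; exact h2)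
    rintro i ⟨_, hi⟩
    rw [hFe, hEe]
    rcases (not_lt.1 hi).lt_or_eq with h | h
    · exact (h1 i h).le
    · rw [← h]; exact h2.le
  -- every y below t in block h is T1
  have allT1 : ∀ X ∈ F, β X.2.1 = h → X.2.1 < t → T1 β h X := by
    intro X hX hq hlt
    by_contra hT
    have hT3 : T3 β h X := ⟨lt_of_le_of_ne (hq ▸ val_le (hFv X hX)) (fun a => hT ⟨a.symm, hq⟩), hq⟩
    exact hS (move3 hm hF hX hT3 ht hlt h2)
  have noc : ∀ X ∈ F, β X.2.1 = h → X.2.1 < t → X.2.2 ≤ t := by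
    intro X hX hq hlt
    by_contra hc
    push Not at hc
    have hT := allT1 X hX hq hlt
    have vX := hFv X hX
    obtain ⟨F', a1, a2, a3⟩ := rep1 hF.fac hX
      (X' := (X.1, t, X.2.2)) (w := (1, t)) (w' := (1, X.2.1))
      ⟨Or.inr ⟨hT.1.trans ht.symm, (T1_lt vX hT).trans hlt⟩, vX.2.1, hc⟩ (by simp only [ex1]; abel)
    simp only [ht, hT.2, hT.1, if_true] at a3
    exact hS (step_B a1 a2 (hT.2.trans ht.symm) h2 (by omega) (Or.inr hlt))
  obtain ⟨Y, hY, hYq, hYt⟩ := cnt_pos (P := fun X => β X.2.1 = h ∧ X.2.1 < t) (F := F) (by omega)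
  have hYT := allT1 Y hY hYq hYt
  have vY := hFv Y hY
  have hYpq := T1_lt vY hYT
  have htG : ¬ Gp β h F t := by
    rintro ⟨X, hX, hXT, b1, b2⟩
    have vX := hFv X hX
    have hlt : β X.2.1 < β Y.1 := by rw [hYT.1]; exact hXT.2
    obtain ⟨F', a1, a2, a3⟩ := rep2 hF.fac hX hY (by rintro rfl; exact hXT.2.ne hYT.2)
      (X' := (X.1, t, X.2.2)) (Y' := (Y.1, X.2.1, Y.2.2)) (w := (1, t)) (w' := (1, Y.2.1))
      ⟨Or.inr ⟨hXT.1.trans ht.symm, b1⟩, vX.2.1, b2⟩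
      ⟨Or.inl hlt, vY.2.1, (hm.reflect_lt hlt).trans vY.2.1⟩ (by simp only [ex1]; abel)
    simp only [ht, hYT.2, hYT.1, hXT.1, hXT.2.ne', if_true, if_false] at a3
    exact hS (step_B a1 a2 (hYT.2.trans ht.symm) h2 (by omega) (Or.inr hYt))
  have no5 : ∀ X ∈ F, β X.1 < h → X.2.2 ≤ t := by
    intro X hX hp
    by_contra hc
    push Not at hc
    have vX := hFv X hX
    have hpY : X.1 < Y.1 := hm.reflect_lt (by rw [hYT.1]; exact hp)
    have hqY : X.2.1 < Y.1 := hm.reflect_lt (by rw [hYT.1]; exact lt_of_le_of_lt (val_le vX) hp)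
    obtain ⟨F', a1, a2, a3⟩ := rep2 hF.fac hX hY (by rintro rfl; exact hp.ne hYT.1)
      (X' := (X.1, X.2.1, Y.2.2)) (Y' := (Y.1, t, X.2.2)) (w := (1, t)) (w' := (1, Y.2.1))
      ⟨vX.1, hpY.trans vY.2.1, hqY.trans vY.2.1⟩
      ⟨Or.inr ⟨hYT.1.trans ht.symm, hYpq.trans hYt⟩, (hYpq.trans hYt).trans hc, hc⟩
      (by simp only [ex1]; abel)
    simp only [ht, hYT.2, hYT.1, if_true] at a3
    exact hS (step_B a1 a2 (hYT.2.trans ht.symm) h2 (by omega) (Or.inr hYt))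
  have M := master (HJ := fun q => True) (cut := fun e => e = t) hm hE.1 hFv
    (ext_gamma hF) (ext_beta hF)
    (fun X hX hT q hq hlt => trivial)
    (fun e he => by
      subst he
      refine ⟨ht, fun X hX hT hlt => ?_⟩
      by_contra hc
      push Not at hc
      have hp : ¬ β X.1 < h := fun a => absurd (no5 X hX a) (not_le.2 hlt)
      have hp' : β X.1 = h := le_antisymm (ht ▸ hm hc.1.le) (not_lt.1 hp)
      have hq' : β X.2.1 = h := by
        by_contra hne
        exact hT ⟨hp', lt_of_le_of_ne (hp' ▸ val_le (hFv X hX)) hne⟩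
      exact absurd (noc X hX hq' hc.2) (not_le.2 hlt))
    (fun q hq p hp => by rw [hFe, hEe]; exact (hA p).symm)
    (fun c => by rw [hFe, hEe]; exact (hC c).symm)
    (fun X hX hq hZ => by
      by_contra hT
      have hT3 : T3 β h X := ⟨lt_of_le_of_ne (hq ▸ val_le (hFv X hX)) (fun a => hT ⟨a.symm, hq⟩), hq⟩
      refine hZ ⟨hq, trivial, ext_noT3 hm hF X hX hT3, ?_⟩
      rintro e rfl
      by_contra hlt
      exact hT (allT1 X hX hq (not_le.1 hlt)))
  set Z := Zp β h F (fun q => True) (fun e => e = t) with hZ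
  have e4 : ∀ D : Multiset (Trip n), cnt (fun X => β X.2.1 = h ∧ ¬ Z X.2.1) D =
      cnt (fun X => β X.2.1 = h ∧ X.2.1 < t) D +
      cnt (fun X => (β X.2.1 = h ∧ ¬ Z X.2.1) ∧ ¬ X.2.1 < t) D := by
    intro D
    rw [cnt_split (fun X => β X.2.1 = h ∧ ¬ Z X.2.1) (fun X => X.2.1 < t) D]
    congr 1
    refine cnt_congr fun X _ => ⟨fun a => ⟨a.1.1, a.2⟩, fun a => ⟨⟨a.1, fun b => ?_⟩, a.2⟩⟩
    exact absurd (b.2.2.2 t rfl) (not_le.2 a.2)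
  have e5 := e4 E
  have e6 := e4 F
  have e7 : cnt (fun X => (β X.2.1 = h ∧ ¬ Z X.2.1) ∧ ¬ X.2.1 < t) E =
      cnt (fun X => (β X.2.1 = h ∧ ¬ Z X.2.1) ∧ ¬ X.2.1 < t) F := by
    refine cnt_co_eq 1 (fun i => (β i = h ∧ ¬ Z i) ∧ ¬ i < t) ?_
    rintro i ⟨⟨a, b⟩, c⟩
    rw [hFe, hEe]
    rcases (not_lt.1 c).lt_or_eq with h | h
    · exact (h1 i h).symm
    · subst h
      refine absurd ⟨ht, trivial, htG, ?_⟩ b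
      rintro e rfl
      exact le_rfl
  omega

end cases
end MF

namespace MF

section core
variable {n r : ℕ} {β : Fin n → Fin r} {E F : Multiset (Trip n)}
  {u v : Fin 3 × Fin n →₀ ℕ}

lemma ins_sum : ins β F = ∑ h, cnt (T1 β h) F := by
  unfold ins
  rw [cnt_fiber (fun X => β X.1)]
  apply Finset.sum_congr rfl
  intro h _
  exact cnt_congr fun X _ => ⟨fun a => ⟨a.2, a.1 ▸ a.2⟩, fun a => ⟨a.1.trans a.2.symm, a.1⟩⟩

lemma core (hm : Monotone β) (hE : Fac β u E) (hF : Fac β v F)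
    (hc : Multiset.card E = Multiset.card F) (hB : Better β u v) : Step β u v := by
  rcases hB with ⟨t, h1, h2⟩ | ⟨hC, ⟨h, h1, h2⟩ | ⟨hb, ⟨t, h1, h2⟩ | ⟨hA, hI⟩⟩⟩
  · exact caseC hF hE.2 hc t h1 h2
  · exact caseb hm hF hE.2 hc h h1 h2
  · obtain ⟨F0, hF0, hi⟩ := exists_iota hF
    obtain ⟨F1, hF1, -⟩ := exists_ext (h := β t) hF0 hi
    refine caseA hm hF1 hE ?_ hC hb t rfl h1 h2
    rw [hc, card_eq, card_eq, hF.2, hF1.fac.2]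
  · obtain ⟨F0, hF0, hi⟩ := exists_iota hF
    obtain ⟨E0, hE0, hi'⟩ := exists_iota hE
    by_cases hh : ∃ h, cnt (T1 β h) F0 < cnt (T1 β h) E0
    · obtain ⟨h, hlt⟩ := hh
      obtain ⟨F1, hF1, h3⟩ := exists_ext (h := h) hF0 hi
      exact caseI hm hF1 hE0 hC hb hA (by omega)
    · push Not at hh
      have hle : ins β E0 ≤ ins β F0 := by
        rw [ins_sum, ins_sum]
        exact Finset.sum_le_sum fun h _ => hh h
      rcases hI with hlt | ⟨heq, t, h1, h2⟩
      · omega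
      · have hall : cnt (T1 β (β t)) F0 = cnt (T1 β (β t)) E0 := by
          apply le_antisymm _ (hh _)
          by_contra hc
          push Not at hc
          have : ins β E0 < ins β F0 := by
            rw [ins_sum, ins_sum]
            exact Finset.sum_lt_sum (fun h _ => hh h) ⟨β t, Finset.mem_univ _, hc⟩
          omega
        obtain ⟨F1, hF1, h3⟩ := exists_ext (h := β t) hF0 hi
        exact caseB hm hF1 hE0 hC hb hA (by omega) t rfl h1 h2

end core

abbrev Key (n r : ℕ) := (Lex ((Fin n)ᵒᵈ → ℕ)) ×ₗ (Lex (Fin r → ℕ)) ×ₗ (Lex (Fin n → ℕ)) ×ₗ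
  ℕ ×ₗ Lex ((Fin n)ᵒᵈ → ℕ)

noncomputable def key {n r : ℕ} (β : Fin n → Fin r) (d : Fin 3 × Fin n →₀ ℕ) : Key n r :=
  toLex (toLex (fun j => d (2, OrderDual.ofDual j)), toLex (toLex (fun s => bs β d s),
    toLex (toLex (fun j => d (0, j)), toLex (iota β d,
      toLex (fun j => d (1, OrderDual.ofDual j))))))

section keys
variable {n r : ℕ} {β : Fin n → Fin r} {u v : Fin 3 × Fin n →₀ ℕ}

lemma lex_lt {ι : Type*} [LinearOrder ι] (f g : ι → ℕ) :
    toLex f < toLex g ↔ ∃ i, (∀ j, j < i → f j = g j) ∧ f i < g i := Iff.rfl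

lemma lex_eq {ι : Type*} (f g : ι → ℕ) :
    toLex f = toLex g ↔ ∀ j, f j = g j := by
  rw [toLex_inj]; exact funext_iff

lemma better_of_key (h : key β v < key β u) : Better β u v := by
  unfold key at h
  simp only [Prod.Lex.toLex_lt_toLex, lex_lt, lex_eq] at h
  exact h

lemma key_of_better (h : Better β u v) : key β v < key β u := by
  unfold key
  simp only [Prod.Lex.toLex_lt_toLex, lex_lt, lex_eq]
  exact h

lemma key_inj (h : key β v = key β u) : v = u := by
  unfold key at h
  simp only [toLex_inj, Prod.mk.injEq, funext_iff] at h
  obtain ⟨h1, -, h2, -, h3⟩ := h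
  ext ⟨k, i⟩
  fin_cases k
  · exact h2 i
  · exact h3 (OrderDual.toDual i)
  · exact h1 (OrderDual.toDual i)
end keys

end MF

namespace MF

lemma linquot_of {σ K : Type} [Field K] (D : List (σ →₀ ℕ))
    (H : ∀ (j : ℕ) (hj : j < D.length), ∀ s ∈ D.take j, ∃ w, ∃ d' ∈ D.take j,
      d' ≤ D[j] + Finsupp.single w 1 ∧ D[j] w < s w) :
    LinQuot (D.map (fun d => (monomial d (1 : K)))) := by
  classical
  intro j
  have hj : j.val < D.length := by simpa using j.isLt
  refine ⟨{w | ∃ d ∈ D.take j.val, d ≤ D[j.val] + Finsupp.single w 1}, ?_⟩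
  have hset : {m | m ∈ (D.map (fun d => (monomial d (1 : K)))).take j.val} =
      (fun d => monomial d (1 : K)) '' {d | d ∈ D.take j.val} := by
    ext m
    rw [Set.mem_setOf_eq, ← List.map_take, List.mem_map]
    rfl
  have hget : (D.map (fun d => (monomial d (1 : K)))).get j = monomial (D[j.val]) 1 := by
    simp
  rw [hset, hget]
  ext f
  have hmem : f ∈ (Ideal.span ((fun d => monomial d (1 : K)) '' {d | d ∈ D.take j.val})).colon
      (Ideal.span {monomial (D[j.val]) (1 : K)} : Set (MvPolynomial σ K)) ↔
      f * monomial (D[j.val]) (1 : K) ∈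
        Ideal.span ((fun d => monomial d (1 : K)) '' {d | d ∈ D.take j.val}) := by
    rw [Submodule.mem_colon]
    constructor
    · intro h
      exact h _ (Ideal.subset_span rfl)
    · intro h s hs
      obtain ⟨a, rfl⟩ := Ideal.mem_span_singleton'.1 hs
      rw [smul_eq_mul, mul_left_comm]
      exact Ideal.mul_mem_left _ _ h
  rw [hmem, mem_ideal_span_monomial_image, mem_ideal_span_X_image]
  constructor
  · intro h m hm
    obtain ⟨s, hs, hle⟩ := h (m + D[j.val]) (by
      rw [mem_support_iff, coeff_mul_monomial, mul_one]
      exact mem_support_iff.1 hm)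
    obtain ⟨w, d', hd', h1, h2⟩ := H j.val hj s hs
    refine ⟨w, ⟨d', hd', h1⟩, ?_⟩
    have := hle w
    rw [Finsupp.add_apply] at this
    omega
  · intro h m hm
    rw [mem_support_iff, coeff_mul_monomial'] at hm
    split_ifs at hm with hle
    · obtain ⟨w, ⟨d, hd, hdle⟩, hw⟩ := h (m - D[j.val]) (by
        rw [mem_support_iff]; simpa using hm)
      refine ⟨d, hd, hdle.trans ?_⟩
      intro a
      have h1 := hle a
      rw [Finsupp.tsub_apply] at hw
      rw [Finsupp.add_apply, Finsupp.single_apply]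
      split_ifs with hwa
      · subst hwa; omega
      · omega
    · exact absurd rfl hm

lemma ex1_monomial (K : Type) [Field K] {n : ℕ} (p q c : Fin n) :
    xv K n p * yv K n q * zv K n c = monomial (ex1 (p, q, c)) 1 := by
  simp [xv, yv, zv, X, ex1, monomial_mul]

lemma Ma_eq (K : Type) [Field K] {n r : ℕ} (β : Fin n → Fin r) (hm : Monotone β) :
    Ma K β = Ideal.span {m | ∃ X, Val β X ∧ m = monomial (ex1 X) (1 : K)} := by
  unfold Ma
  congr 1
  ext m
  constructor
  · rintro ⟨i, j, k, hij, hjk, rfl⟩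
    unfold mfMono
    split_ifs with hb
    · exact ⟨(i, j, k), ⟨Or.inr ⟨hb, hij⟩, hij.trans hjk, hjk⟩, ex1_monomial ..⟩
    · exact ⟨(j, i, k), ⟨Or.inl (lt_of_le_of_ne (hm hij.le) hb), hjk, hij.trans hjk⟩,
        ex1_monomial ..⟩
  · rintro ⟨⟨p, q, c⟩, ⟨hV, h1, h2⟩, rfl⟩
    rcases hV with h | h
    · refine ⟨q, p, c, hm.reflect_lt h, h1, ?_⟩
      unfold mfMono
      rw [if_neg h.ne, ex1_monomial]
    · refine ⟨p, q, c, h.2, h2, ?_⟩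
      unfold mfMono
      rw [if_pos h.1, ex1_monomial]

lemma Ma_pow (K : Type) [Field K] {n r : ℕ} (β : Fin n → Fin r) (hm : Monotone β) (ℓ : ℕ) :
    (Ma K β) ^ ℓ = Ideal.span {m | ∃ F : Multiset (Trip n), (∀ X ∈ F, Val β X) ∧
      Multiset.card F = ℓ ∧ m = monomial (expo F) (1 : K)} := by
  induction ℓ with
  | zero =>
    rw [pow_zero, Ideal.one_eq_top, eq_comm, Ideal.eq_top_iff_one]
    exact Ideal.subset_span ⟨0, by simp, by simp, by simp⟩
  | succ ℓ ih =>
    rw [pow_succ, ih, Ma_eq K β hm, Ideal.span_mul_span']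
    congr 1
    ext m
    rw [Set.mem_mul]
    constructor
    · rintro ⟨_, ⟨F, hF, hc, rfl⟩, _, ⟨X, hX, rfl⟩, rfl⟩
      refine ⟨X ::ₘ F, ?_, by simp [hc], by simp [monomial_mul, add_comm]⟩
      intro Y hY
      rcases Multiset.mem_cons.1 hY with rfl | hY
      exacts [hX, hF Y hY]
    · rintro ⟨F, hF, hc, rfl⟩
      obtain ⟨X, hX⟩ := Multiset.card_pos_iff_exists_mem.1 (by omega : 0 < Multiset.card F)
      obtain ⟨R, rfl⟩ := Multiset.exists_cons_of_mem hX
      refine ⟨_, ⟨R, fun Y hY => hF Y (Multiset.mem_cons_of_mem hY), by simpa using hc, rfl⟩,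
        _, ⟨X, hF X hX, rfl⟩, by simp [monomial_mul, add_comm]⟩

lemma degree_expo {n : ℕ} (F : Multiset (Trip n)) :
    (expo F).degree = 3 * Multiset.card F := by
  induction F using Multiset.induction_on with
  | empty => simp
  | cons X F ih =>
    rw [expo_cons, map_add, ih]
    simp [ex1]
    ring

lemma gens_finite {n r : ℕ} (β : Fin n → Fin r) (ℓ : ℕ) :
    {d | ∃ F : Multiset (Trip n), Fac β d F ∧ Multiset.card F = ℓ}.Finite := by
  classical
  apply (Set.finite_range (fun s : Sym (Trip n) ℓ => expo s.1)).subset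
  rintro d ⟨F, hF, hc⟩
  exact ⟨⟨F, hc⟩, hF.2⟩

end MF

namespace MF
theorem main (K : Type) [Field K] (n r : ℕ) (hn : 3 ≤ n)
    (β : Fin n → Fin r) (hmono : Monotone β) (hsurj : Function.Surjective β)
    (ℓ : ℕ) (hℓ : 1 ≤ ℓ) :
    ∃ L : List (PR K n),
      L.Nodup ∧
      (∀ m ∈ L, ∃ d : (Fin 3 × Fin n) →₀ ℕ, m = monomial d 1) ∧
      (∀ m ∈ L, ∀ m' ∈ L, m ≠ m' → ¬ m ∣ m') ∧
      Ideal.span {m | m ∈ L} = (Ma K β) ^ ℓ ∧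
      LinQuot L := by
  classical
  have hfin := gens_finite β ℓ
  let R : (Fin 3 × Fin n →₀ ℕ) → (Fin 3 × Fin n →₀ ℕ) → Prop := fun a b => key β b ≤ key β a
  have : Std.Total R := ⟨fun a b => le_total _ _⟩
  have : IsTrans _ R := ⟨fun a b c h1 h2 => le_trans h2 h1⟩
  let D := List.insertionSort R hfin.toFinset.toList
  have hD : ∀ d, d ∈ D ↔ ∃ F : Multiset (Trip n), Fac β d F ∧ Multiset.card F = ℓ := by
    intro d
    rw [(List.perm_insertionSort R _).mem_iff]
    simp
  have hDnd : D.Nodup := (List.perm_insertionSort R _).nodup_iff.2 (Finset.nodup_toList _)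
  have hDs : D.Pairwise R := List.pairwise_insertionSort R _
  have hinj : Function.Injective (fun d : Fin 3 × Fin n →₀ ℕ => (monomial d (1 : K))) :=
    fun a b h => monomial_left_injective one_ne_zero h
  refine ⟨D.map (fun d => monomial d (1 : K)), hDnd.map hinj, ?_, ?_, ?_, linquot_of D ?_⟩
  · intro m hm
    obtain ⟨d, -, rfl⟩ := List.mem_map.1 hm
    exact ⟨d, rfl⟩
  · intro m hm m' hm' hne hdvd
    obtain ⟨d, hd, rfl⟩ := List.mem_map.1 hm
    obtain ⟨d', hd', rfl⟩ := List.mem_map.1 hm'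
    obtain ⟨F, hF, hc⟩ := (hD d).1 hd
    obtain ⟨F', hF', hc'⟩ := (hD d').1 hd'
    rw [monomial_dvd_monomial] at hdvd
    have hle : d ≤ d' := by simpa using hdvd.1
    obtain ⟨e, rfl⟩ := le_iff_exists_add.1 hle
    have h1 := degree_expo F
    have h2 := degree_expo F'
    rw [hF.2, hc] at h1
    rw [hF'.2, hc', map_add] at h2
    have h3 : e.degree = 0 := by omega
    rw [Finsupp.degree_eq_zero_iff] at h3
    subst h3
    exact hne (by simp)
  · rw [Ma_pow K β hmono]
    congr 1
    ext m
    simp only [Set.mem_setOf_eq, List.mem_map, hD]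
    constructor
    · rintro ⟨d, ⟨F, hF, hc⟩, rfl⟩
      exact ⟨F, hF.1, hc, by rw [hF.2]⟩
    · rintro ⟨F, hF, hc, rfl⟩
      exact ⟨_, ⟨F, ⟨hF, rfl⟩, hc⟩, rfl⟩
  · intro j hj s hs
    obtain ⟨i, hi, rfl⟩ := List.mem_take_iff_getElem.1 hs
    have hij : i < j := by omega
    have hiD : i < D.length := by omega
    have hle : key β D[j] ≤ key β D[i] := List.pairwise_iff_getElem.1 hDs i j hiD hj hij
    have hlt : key β D[j] < key β D[i] := by
      apply lt_of_le_of_ne hle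
      intro h
      have := (hDnd.getElem_inj_iff).1 (key_inj h)
      omega
    obtain ⟨E, hE, hEc⟩ := (hD D[i]).1 (List.getElem_mem hiD)
    obtain ⟨F, hF, hFc⟩ := (hD D[j]).1 (List.getElem_mem hj)
    obtain ⟨w, w', F', hV, h1, h2, h3⟩ := core hmono hE hF (hEc.trans hFc.symm) (better_of_key hlt)
    have hcard : Multiset.card F' = ℓ := by
      have a1 := congrArg Finsupp.degree h1
      have a2 := degree_expo F
      rw [hF.2] at a2
      rw [map_add, map_add, degree_expo, a2] at a1
      simp at a1
      omega
    have hmem : expo F' ∈ D := (hD _).2 ⟨F', ⟨hV, rfl⟩, hcard⟩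
    refine ⟨w, expo F', ?_, ?_, h2⟩
    · obtain ⟨k, hk, hke⟩ := List.mem_iff_getElem.1 hmem
      have h4 := key_of_better h3
      rw [← hke] at h4 ⊢
      have hkj : k < j := by
        by_contra hc
        rcases (not_lt.1 hc).lt_or_eq with h | h
        · exact absurd (List.pairwise_iff_getElem.1 hDs j k hj hk h) (not_le.2 h4)
        · subst h; exact lt_irrefl _ h4
      exact List.mem_take_iff_getElem.2 ⟨k, by omega, rfl⟩
    · rw [← h1]; exact le_self_add

end MF

/-- For every partition `a` of `[n]` and every `ℓ ≥ 1`, the power `(M_a)^ℓ` of the block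
diagonal matching field ideal has linear quotients: there is an ordering of its minimal
monomial generators (a duplicate-free list of monomials, none dividing another, spanning
`(M_a)^ℓ`) for which every colon ideal by the earlier generators is generated by
variables. -/
theorem stmt_12 (K : Type) [Field K] (n r : ℕ) (hn : 3 ≤ n)
    (β : Fin n → Fin r) (hmono : Monotone β) (hsurj : Function.Surjective β)
    (ℓ : ℕ) (hℓ : 1 ≤ ℓ) :
    ∃ L : List (PR K n),
      L.Nodup ∧
      (∀ m ∈ L, ∃ d : (Fin 3 × Fin n) →₀ ℕ, m = monomial d 1) ∧
      (∀ m ∈ L, ∀ m' ∈ L, m ≠ m' → ¬ m ∣ m') ∧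
      Ideal.span {m | m ∈ L} = (Ma K β) ^ ℓ ∧
      LinQuot L := by
  exact MF.main K n r hn β hmono hsurj ℓ hℓ
end
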